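/- Under Assumptions 1 and 2, there exists a mechanism that involves no costly screening and whose principal payoff equals the supremum of the principal's payoff over all mechanisms; that is, an optimal mechanism involving no costly screening exists. -/

import Mathlib

open MeasureTheory Set ProbabilityTheory

noncomputable section

/-- `κ` is a regular conditional distribution of the second coordinate given the
first coordinate, under the joint law `γ`. -/
def IsRCD {A B : Type*} [MeasurableSpace A] [MeasurableSpace B]
    (γ : Measure (A × B)) (κ : Kernel A B) : Prop :=
  IsMarkovKernel κ ∧
    ∀ s : Set (A × B), MeasurableSet s →
      γ s = ∫⁻ a, κ a {b | (a, b) ∈ s} ∂γ.fst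

/-- The topological support of a measure on `ℝ`. -/
def MSupport (μ : Measure ℝ) : Set ℝ :=
  {a | ∀ U : Set ℝ, IsOpen U → a ∈ U → 0 < μ U}

variable {N : ℕ} {Y : Type} [MeasurableSpace Y]

/-- A measurable IC and IR mechanism in the two-component screening model (with
integrable transfer, so that the principal's payoff is well defined). -/
def Mechanism (ΘA : Set ℝ) (ΘB : Set (Fin N → ℝ)) (X : Set ℝ)
    (uA : ℝ → ℝ → ℝ) (uB : Y → (Fin N → ℝ) → ℝ)
    (γ : Measure (ℝ × (Fin N → ℝ)))
    (x : ℝ × (Fin N → ℝ) → ℝ) (y : ℝ × (Fin N → ℝ) → Y)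
    (t : ℝ × (Fin N → ℝ) → ℝ) : Prop :=
  Measurable x ∧ Measurable y ∧ Measurable t ∧ Integrable t γ ∧
    (∀ θ ∈ ΘA ×ˢ ΘB, x θ ∈ X) ∧
    (∀ θ ∈ ΘA ×ˢ ΘB, ∀ θ' ∈ ΘA ×ˢ ΘB,
      uA (x θ) θ.1 + uB (y θ) θ.2 - t θ ≥ uA (x θ') θ.1 + uB (y θ') θ.2 - t θ') ∧
    (∀ θ ∈ ΘA ×ˢ ΘB, uA (x θ) θ.1 + uB (y θ) θ.2 - t θ ≥ 0)

/-- The principal's expected payoff. -/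
def Payoff (vA : ℝ → ℝ → ℝ) (vB : Y → (Fin N → ℝ) → ℝ)
    (γ : Measure (ℝ × (Fin N → ℝ)))
    (x : ℝ × (Fin N → ℝ) → ℝ) (y : ℝ × (Fin N → ℝ) → Y)
    (t : ℝ × (Fin N → ℝ) → ℝ) : ℝ :=
  ∫ θ, (vA (x θ) θ.1 + vB (y θ) θ.2 + t θ) ∂γ

/-- A mechanism involves no costly screening: `y ≡ y₀` and `(x, t)` depend only on
the productive type `θ^A`. -/
def NoCostlyScreening (y₀ : Y)
    (x : ℝ × (Fin N → ℝ) → ℝ) (y : ℝ × (Fin N → ℝ) → Y)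
    (t : ℝ × (Fin N → ℝ) → ℝ) : Prop :=
  (∀ θ, y θ = y₀) ∧
    ∀ θ θ' : ℝ × (Fin N → ℝ), θ.1 = θ'.1 → x θ = x θ' ∧ t θ = t θ'

/-- Lexicographic maximization of three continuous functions on a compact set. -/
theorem IsCompact.exists_lex_max {E : Type*} [TopologicalSpace E] {K : Set E} (hK : IsCompact K)
    (hne : K.Nonempty) {f g h : E → ℝ} (hf : Continuous f) (hg : Continuous g)
    (hh : Continuous h) :
    ∃ q ∈ K, (∀ q' ∈ K, f q' ≤ f q) ∧ (∀ q' ∈ K, f q ≤ f q' → g q' ≤ g q) ∧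
      (∀ q' ∈ K, f q ≤ f q' → g q ≤ g q' → h q' ≤ h q) := by
  obtain ⟨a, haK, ha⟩ := hK.exists_isMaxOn hne hf.continuousOn
  have hK1 : IsCompact (K ∩ {q | f a ≤ f q}) :=
    hK.inter_right (isClosed_le continuous_const hf)
  obtain ⟨b, hb, hbmax⟩ := hK1.exists_isMaxOn ⟨a, haK, le_refl (f a)⟩ hg.continuousOn
  have hK2 : IsCompact (K ∩ {q | f a ≤ f q} ∩ {q | g b ≤ g q}) :=
    hK1.inter_right (isClosed_le continuous_const hg)
  obtain ⟨c, hc, hcmax⟩ := hK2.exists_isMaxOn ⟨b, hb, le_refl (g b)⟩ hh.continuousOn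
  have hac : f a ≤ f c := hc.1.2
  have hbc : g b ≤ g c := hc.2
  refine ⟨c, hc.1.1, fun q hq => (ha hq).trans hac, fun q hq h1 => ?_, fun q hq h1 h2 => ?_⟩
  · exact (hbmax (show q ∈ K ∩ {q | f a ≤ f q} from ⟨hq, hac.trans h1⟩)).trans hbc
  · exact hcmax (show q ∈ K ∩ {q | f a ≤ f q} ∩ {q | g b ≤ g q} from
      ⟨⟨hq, hac.trans h1⟩, hbc.trans h2⟩)

/-- With finitely many productive types, a mechanism satisfying the downward incentive constraints
is weakly dominated by a monotone one satisfying all incentive constraints. -/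
theorem exists_monotone_of_downwardIC {ι : Type*} [Fintype ι] [LinearOrder ι] [Nonempty ι]
    {a : ι → ℝ} {X : Set ℝ} (hX : IsCompact X) {u s : ℝ → ℝ → ℝ}
    (hu : ∀ i, Continuous fun x => u x (a i)) (hs : ∀ i, Continuous fun x => s x (a i))
    {M : ℝ} (hM : ∀ x ∈ X, ∀ i, |u x (a i)| ≤ M)
    (hmono : ∀ x ∈ X, ∀ i j, i ≤ j → u x (a i) ≤ u x (a j))
    (hid : ∀ x ∈ X, ∀ x' ∈ X, x < x' → ∀ i j, i < j →
      u x' (a i) - u x (a i) < u x' (a j) - u x (a j))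
    (hsc : ∀ x ∈ X, ∀ x' ∈ X, x < x' → ∀ i j, i < j →
      0 < s x' (a i) - s x (a i) → 0 < s x' (a j) - s x (a j))
    {p : ι → ℝ} (hp : ∀ i, 0 ≤ p i) {x₀ U₀ : ι → ℝ} (hx₀ : ∀ i, x₀ i ∈ X) (hU₀ : ∀ i, 0 ≤ U₀ i)
    (hdown : ∀ i j, i < j → U₀ i + (u (x₀ i) (a j) - u (x₀ i) (a i)) ≤ U₀ j) :
    ∃ x U : ι → ℝ, Monotone x ∧ Monotone U ∧ (∀ i, x i ∈ X) ∧ (∀ i, 0 ≤ U i) ∧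
      (∀ i, U i ≤ 2 * M) ∧
      (∀ i j, U i + (u (x i) (a j) - u (x i) (a i)) ≤ U j) ∧
      ∑ i, p i * (s (x₀ i) (a i) - U₀ i) ≤ ∑ i, p i * (s (x i) (a i) - U i) := by
  classical
  set C : ℝ := ∑ i, U₀ i
  have hC : ∀ i, U₀ i ≤ C := fun i =>
    Finset.single_le_sum (f := U₀) (fun j _ => hU₀ j) (Finset.mem_univ i)
  let K : Set ((ι → ℝ) × (ι → ℝ)) := (Set.univ.pi fun _ => X) ×ˢ (Set.univ.pi fun _ => Icc 0 C) ∩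
    {q | ∀ i j, i < j → q.2 i + (u (q.1 i) (a j) - u (q.1 i) (a i)) ≤ q.2 j}
  have hKdef : ∀ x U : ι → ℝ, (x, U) ∈ K ↔ (∀ i, x i ∈ X) ∧ (∀ i, 0 ≤ U i ∧ U i ≤ C) ∧
      ∀ i j, i < j → U i + (u (x i) (a j) - u (x i) (a i)) ≤ U j := by
    intro x U
    simp only [K, mem_inter_iff, mem_prod, Set.mem_pi, Set.mem_univ, forall_true_left, mem_Icc,
      mem_ofPred_eq, and_assoc]
  have hcu : ∀ i j, Continuous fun q : (ι → ℝ) × (ι → ℝ) => u (q.1 i) (a j) := fun i j =>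
    (hu j).comp (by fun_prop : Continuous fun q : (ι → ℝ) × (ι → ℝ) => q.1 i)
  have hcs : ∀ i j, Continuous fun q : (ι → ℝ) × (ι → ℝ) => s (q.1 i) (a j) := fun i j =>
    (hs j).comp (by fun_prop : Continuous fun q : (ι → ℝ) × (ι → ℝ) => q.1 i)
  have hK : IsCompact K := by
    refine ((isCompact_univ_pi fun _ => hX).prod (isCompact_univ_pi fun _ => isCompact_Icc)).inter_right ?_
    simp only [ofPred_forall]
    refine isClosed_iInter fun i => isClosed_iInter fun j => isClosed_iInter fun _ => ?_
    exact isClosed_le (by have := hcu i j; have := hcu i i; fun_prop) (by fun_prop)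
  have hK₀ : (x₀, U₀) ∈ K := (hKdef _ _).2 ⟨hx₀, fun i => ⟨hU₀ i, hC i⟩, hdown⟩
  obtain ⟨⟨x, U⟩, hqK, hW, hW', hS⟩ := hK.exists_lex_max ⟨_, hK₀⟩
    (f := fun q => ∑ i, p i * (s (q.1 i) (a i) - q.2 i))
    (g := fun q => ∑ i, (s (q.1 i) (a i) - q.2 i)) (h := fun q => - ∑ i, q.1 i)
    (continuous_finsetSum _ fun i _ => by have := hcs i i; fun_prop)
    (continuous_finsetSum _ fun i _ => by have := hcs i i; fun_prop)
    (by fun_prop)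
  obtain ⟨hxX, hU, hdn⟩ := (hKdef _ _).1 hqK
  -- a competitor that is pointwise weakly better and strictly better somewhere is impossible
  have payoff_le_of_mem : ∀ x' U' : ι → ℝ, (x', U') ∈ K → (∀ i, s (x i) (a i) - U i ≤ s (x' i) (a i) - U' i) →
      ∀ j, s (x' j) (a j) - U' j ≤ s (x j) (a j) - U j := by
    intro x' U' hK' hle j
    by_contra! hlt
    have h1 := hW' _ hK' (Finset.sum_le_sum fun i _ => mul_le_mul_of_nonneg_left (hle i) (hp i))
    exact absurd h1 (not_le.2 (Finset.sum_lt_sum (fun i _ => hle i) ⟨j, Finset.mem_univ j, hlt⟩))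
  have sum_le_of_mem : ∀ x' U' : ι → ℝ, (x', U') ∈ K → (∀ i, s (x i) (a i) - U i ≤ s (x' i) (a i) - U' i) →
      ∑ i, x i ≤ ∑ i, x' i := by
    intro x' U' hK' hle
    have h1 := hS _ hK' (Finset.sum_le_sum fun i _ => mul_le_mul_of_nonneg_left (hle i) (hp i))
      (Finset.sum_le_sum fun i _ => hle i)
    simpa using h1
  have lower : ∀ j V, 0 ≤ V → V ≤ U j →
      (∀ i, i < j → U i + (u (x i) (a j) - u (x i) (a i)) ≤ V) → U j ≤ V := by
    intro j V hV0 hVU hV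
    have hK' : (x, Function.update U j V) ∈ K := by
      refine (hKdef _ _).2 ⟨hxX, fun i => ?_, fun i k hik => ?_⟩
      · by_cases hij : i = j
        · subst hij; simpa using ⟨hV0, hVU.trans (hU i).2⟩
        · simpa [hij] using hU i
      · by_cases hij : i = j
        · subst hij
          have := hdn i k hik
          simp only [Function.update_self, Function.update_of_ne hik.ne']
          linarith
        · by_cases hkj : k = j
          · subst hkj; simpa [hij] using hV i hik
          · simpa [hij, hkj] using hdn i k hik
    have := payoff_le_of_mem x _ hK' (fun i => by
      by_cases hij : i = j
      · subst hij
        simp only [Function.update_self]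
        linarith
      · simp [hij]) j
    simp only [Function.update_self] at this
    linarith
  have hDnn : ∀ y ∈ X, ∀ i j, i ≤ j → 0 ≤ u y (a j) - u y (a i) := fun y hy i j hij =>
    sub_nonneg.2 (hmono y hy i j hij)
  have bind : ∀ j, (∃ i, i < j) → ∃ i < j, U j = U i + (u (x i) (a j) - u (x i) (a i)) := by
    rintro j ⟨i0, hi0⟩
    obtain ⟨i, hi, himax⟩ := Finset.exists_max_image (Finset.univ.filter (· < j))
      (fun i => U i + (u (x i) (a j) - u (x i) (a i))) ⟨i0, by simpa using hi0⟩
    have hij : i < j := by simpa using hi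
    refine ⟨i, hij, le_antisymm (lower j _ ?_ (hdn i j hij) fun i' hi' => himax i' (by simpa using hi'))
      (hdn i j hij)⟩
    exact add_nonneg (hU i).1 (hDnn _ (hxX i) i j hij.le)
  have bot0 : ∀ j, (¬ ∃ i, i < j) → U j = 0 := fun j hj =>
    le_antisymm (lower j 0 le_rfl (hU j).1 fun i hi => (hj ⟨i, hi⟩).elim) (hU j).1
  have exch : ∀ i j, i < j → U j = U i + (u (x i) (a j) - u (x i) (a i)) → x i ≤ x j := by
    intro i j hij hb
    by_contra! hlt
    by_cases hcase : s (x j) (a j) < s (x i) (a j)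
    · have hK' : (Function.update x j (x i), U) ∈ K := by
        refine (hKdef _ _).2 ⟨fun k => ?_, hU, fun k l hkl => ?_⟩
        · by_cases hk : k = j
          · subst hk; simpa using hxX i
          · simpa [hk] using hxX k
        · by_cases hk : k = j
          · subst hk
            have := hdn i l (hij.trans hkl)
            simp only [Function.update_self]
            linarith
          · simpa [hk] using hdn k l hkl
      have := payoff_le_of_mem _ U hK' (fun k => by
        by_cases hk : k = j
        · subst hk; simpa using hcase.le
        · simp [hk]) j
      simp only [Function.update_self] at this
      linarith
    · have hsi : s (x i) (a i) ≤ s (x j) (a i) := by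
        by_contra! h
        have := hsc _ (hxX j) _ (hxX i) hlt i j hij (by linarith)
        exact hcase (by linarith)
      have hK' : (Function.update x i (x j), U) ∈ K := by
        refine (hKdef _ _).2 ⟨fun k => ?_, hU, fun k l hkl => ?_⟩
        · by_cases hk : k = i
          · subst hk; simpa using hxX j
          · simpa [hk] using hxX k
        · by_cases hk : k = i
          · subst hk
            have h1 := hdn k l hkl
            have h2 := hid _ (hxX j) _ (hxX k) hlt k l hkl
            simp only [Function.update_self]
            linarith
          · simpa [hk] using hdn k l hkl
      have h1 := sum_le_of_mem _ U hK' (fun k => by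
        by_cases hk : k = i
        · subst hk; simpa using hsi
        · simp [hk])
      have h2 : ∑ k, Function.update x i (x j) k < ∑ k, x k := by
        refine Finset.sum_lt_sum (fun k _ => ?_) ⟨i, Finset.mem_univ i, by simpa using hlt⟩
        by_cases hk : k = i
        · subst hk; simpa using hlt.le
        · simp [hk]
      linarith
  have hidle : ∀ y ∈ X, ∀ y' ∈ X, y ≤ y' → ∀ i j, i ≤ j →
      u y' (a i) - u y (a i) ≤ u y' (a j) - u y (a j) := by
    intro y hy y' hy' hyy i j hij
    rcases hyy.eq_or_lt with rfl | h1
    · simp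
    rcases hij.eq_or_lt with rfl | h2
    · exact le_rfl
    exact (hid y hy y' hy' h1 i j h2).le
  have xmono : ∀ j, ∀ i ≤ j, x i ≤ x j := by
    intro j
    induction j using WellFoundedLT.induction with
    | ind j ih =>
      intro i' hi'
      rcases hi'.eq_or_lt with rfl | hlt
      · exact le_rfl
      obtain ⟨i, hij, hb⟩ := bind j ⟨i', hlt⟩
      have hxij := exch i j hij hb
      rcases le_or_gt i' i with h | h
      · exact (ih i hij i' h).trans hxij
      · by_contra! hcon
        have h1 := hdn i i' h
        have h2 := hdn i' j hlt
        have h3 := hid _ (hxX i) _ (hxX i') (hxij.trans_lt hcon) i' j hlt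
        linarith
  have up : ∀ j, ∀ i < j, U j + (u (x j) (a i) - u (x j) (a j)) ≤ U i := by
    intro j
    induction j using WellFoundedLT.induction with
    | ind j ih =>
      intro i hij
      obtain ⟨c, hcj, hb⟩ := bind j ⟨i, hij⟩
      have h1 := hidle _ (hxX c) _ (hxX j) (xmono j c hcj.le) i j hij.le
      rcases lt_trichotomy c i with h | rfl | h
      · have := hdn c i h
        linarith
      · linarith
      · have := ih c hcj i h
        linarith
  have hIC : ∀ i j, U i + (u (x i) (a j) - u (x i) (a i)) ≤ U j := by
    intro i j
    rcases lt_trichotomy i j with h | rfl | h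
    · exact hdn i j h
    · simp
    · exact up i j h
  refine ⟨x, U, fun i j hij => xmono j i hij, fun i j hij => ?_, hxX, fun i => (hU i).1, fun i => ?_,
    hIC, hW _ hK₀⟩
  · have := hIC i j
    have := hDnn _ (hxX i) i j hij
    linarith
  · obtain ⟨m, hm⟩ := Finite.exists_min (id : ι → ι)
    have h0 : U m = 0 := bot0 m fun ⟨k, hk⟩ => absurd (hm k) (not_le.2 hk)
    have h1 := hIC i m
    have h2 := abs_le.1 (hM _ (hxX i) m)
    have h3 := abs_le.1 (hM _ (hxX i) i)
    linarith

/-- The pair `(x, U)` of allocations and utilities satisfies the downward incentive constraints on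
the finite type set `T`, and gives every type at least the utility prescribed by `w`. -/
def DownwardFeasible (X : Set ℝ) (u : ℝ → ℝ → ℝ) (T : Finset ℝ) (w x U : ℝ → ℝ) : Prop :=
  (∀ a ∈ T, x a ∈ X ∧ w a ≤ U a) ∧
    ∀ a ∈ T, ∀ a' ∈ T, a < a' → U a + (u (x a) a' - u (x a) a) ≤ U a'

/-- The payoffs attainable under the downward incentive constraints. -/
def downwardPayoffs (X : Set ℝ) (u s : ℝ → ℝ → ℝ) (p : ℝ → ℝ) (T : Finset ℝ) (w : ℝ → ℝ) : Set ℝ :=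
  {c | ∃ x U, DownwardFeasible X u T w x U ∧ c = ∑ a ∈ T, p a * (s (x a) a - U a)}

/-- The value of the downward-constrained problem with prescribed utilities `w`. -/
def downwardValue (X : Set ℝ) (u s : ℝ → ℝ → ℝ) (p : ℝ → ℝ) (T : Finset ℝ) (w : ℝ → ℝ) : ℝ :=
  sSup (downwardPayoffs X u s p T w)

section DownwardValue

variable {X : Set ℝ} {u s : ℝ → ℝ → ℝ} {p : ℝ → ℝ} {T : Finset ℝ}

theorem downwardPayoffs_nonempty (hX : X.Nonempty) (w : ℝ → ℝ) :
    (downwardPayoffs X u s p T w).Nonempty := by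
  obtain ⟨x₀, hx₀⟩ := hX
  obtain ⟨c, hc⟩ : ∃ c, ∀ a ∈ T, w a - u x₀ a ≤ c :=
    (T.image fun a => w a - u x₀ a).bddAbove.imp fun c hc a ha =>
      hc (Finset.mem_coe.2 (Finset.mem_image_of_mem _ ha))
  refine ⟨_, fun _ => x₀, fun a => c + u x₀ a, ⟨fun a ha => ⟨hx₀, ?_⟩, fun a _ a' _ _ => ?_⟩, rfl⟩
  · linarith [hc a ha]
  · linarith

theorem downwardPayoffs_bddAbove (hp : ∀ a, 0 ≤ p a) {S : ℝ} (hS : ∀ x ∈ X, ∀ a ∈ T, |s x a| ≤ S)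
    (w : ℝ → ℝ) : BddAbove (downwardPayoffs X u s p T w) := by
  refine ⟨∑ a ∈ T, p a * (S - w a), ?_⟩
  rintro _ ⟨x, U, h, rfl⟩
  refine Finset.sum_le_sum fun a ha => mul_le_mul_of_nonneg_left ?_ (hp a)
  have := (abs_le.1 (hS _ (h.1 a ha).1 a ha)).2
  linarith [(h.1 a ha).2]

theorem downwardValue_le_add (hX : X.Nonempty) (hp : ∀ a, 0 ≤ p a) {S : ℝ}
    (hS : ∀ x ∈ X, ∀ a ∈ T, |s x a| ≤ S) {w w' : ℝ → ℝ} {c : ℝ} (h : ∀ a ∈ T, w' a ≤ w a + c) :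
    downwardValue X u s p T w ≤ downwardValue X u s p T w' + c * ∑ a ∈ T, p a := by
  refine csSup_le (downwardPayoffs_nonempty hX w) ?_
  rintro _ ⟨x, U, hf, rfl⟩
  have : ∑ a ∈ T, p a * (s (x a) a - (U a + c)) ≤ downwardValue X u s p T w' :=
    le_csSup (downwardPayoffs_bddAbove hp hS w') ⟨x, fun a => U a + c, ⟨fun a ha =>
      ⟨(hf.1 a ha).1, by linarith [h a ha, (hf.1 a ha).2]⟩, fun a ha a' ha' haa => by
        linarith [hf.2 a ha a' ha' haa]⟩, rfl⟩
  have e : ∑ a ∈ T, p a * (s (x a) a - (U a + c)) =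
      ∑ a ∈ T, p a * (s (x a) a - U a) - c * ∑ a ∈ T, p a := by
    rw [Finset.mul_sum, ← Finset.sum_sub_distrib]
    exact Finset.sum_congr rfl fun a _ => by ring
  linarith

theorem downwardValue_anti (hX : X.Nonempty) (hp : ∀ a, 0 ≤ p a) {S : ℝ}
    (hS : ∀ x ∈ X, ∀ a ∈ T, |s x a| ≤ S) {w w' : ℝ → ℝ} (h : ∀ a ∈ T, w' a ≤ w a) :
    downwardValue X u s p T w ≤ downwardValue X u s p T w' := by
  simpa using downwardValue_le_add (c := 0) hX hp hS (w := w) (w' := w') (u := u) (by simpa using h)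

theorem abs_downwardValue_sub_le (hX : X.Nonempty) (hp : ∀ a, 0 ≤ p a) {S : ℝ}
    (hS : ∀ x ∈ X, ∀ a ∈ T, |s x a| ≤ S) {w w' : ℝ → ℝ} {c : ℝ} (h : ∀ a ∈ T, |w a - w' a| ≤ c) :
    |downwardValue X u s p T w - downwardValue X u s p T w'| ≤ c * ∑ a ∈ T, p a := by
  have h1 := downwardValue_le_add (w := w) (w' := w') (c := c) (u := u) hX hp hS fun a ha => by
    linarith [(abs_le.1 (h a ha)).1]
  have h2 := downwardValue_le_add (w := w') (w' := w) (c := c) (u := u) hX hp hS fun a ha => by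
    linarith [(abs_le.1 (h a ha)).2]
  exact abs_le.2 ⟨by linarith, by linarith⟩

theorem abs_downwardValue_le (hX : X.Nonempty) (hp : ∀ a, 0 ≤ p a) {S : ℝ}
    (hS : ∀ x ∈ X, ∀ a ∈ T, |s x a| ≤ S) {w : ℝ → ℝ} {c : ℝ} (h : ∀ a ∈ T, |w a| ≤ c) :
    |downwardValue X u s p T w| ≤ |downwardValue X u s p T 0| + c * ∑ a ∈ T, p a := by
  have h1 := abs_downwardValue_sub_le (w := w) (w' := 0) (c := c) (u := u) hX hp hS (by simpa)
  have h2 := abs_sub_abs_le_abs_sub (downwardValue X u s p T w) (downwardValue X u s p T 0)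
  linarith

theorem add_downwardValue_le (hX : X.Nonempty) (hp : ∀ a, 0 ≤ p a) {S : ℝ} {a₀ : ℝ}
    (hS : ∀ x ∈ X, ∀ a ∈ insert a₀ T, |s x a| ≤ S) (ha₀ : ∀ a ∈ T, a₀ < a) {w : ℝ → ℝ} {x₀ : ℝ}
    (hx₀ : x₀ ∈ X) (h : ∀ a ∈ T, w a₀ + (u x₀ a - u x₀ a₀) ≤ w a) :
    p a₀ * (s x₀ a₀ - w a₀) + downwardValue X u s p T w ≤
      downwardValue X u s p (insert a₀ T) w := by
  rw [← le_sub_iff_add_le']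
  refine csSup_le (downwardPayoffs_nonempty hX w) ?_
  rintro _ ⟨x, U, hf, rfl⟩
  rw [le_sub_iff_add_le']
  have hnot : a₀ ∉ T := fun h => lt_irrefl _ (ha₀ _ h)
  have hne : ∀ a ∈ T, a ≠ a₀ := fun a ha => (ha₀ a ha).ne'
  refine le_csSup (downwardPayoffs_bddAbove hp hS w)
    ⟨Function.update x a₀ x₀, Function.update U a₀ (w a₀), ⟨fun a ha => ?_,
      fun a ha a' ha' haa => ?_⟩, ?_⟩
  · rcases Finset.mem_insert.1 ha with rfl | ha
    · simpa using hx₀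
    · simpa [hne a ha] using hf.1 a ha
  · have ha'T : a' ∈ T := (Finset.mem_insert.1 ha').resolve_left fun h' =>
      (Finset.mem_insert.1 ha).elim (fun h'' => by linarith) fun h'' => by linarith [ha₀ a h'']
    rcases Finset.mem_insert.1 ha with rfl | ha
    · simpa [hne a' ha'T] using (h a' ha'T).trans (hf.1 a' ha'T).2
    · simpa [hne a ha, hne a' ha'T] using hf.2 a ha a' ha'T haa
  · rw [Finset.sum_insert hnot]
    simp only [Function.update_self, add_right_inj]
    exact Finset.sum_congr rfl fun a ha => by simp [hne a ha]

theorem measurable_downwardValue (hX : X.Nonempty) (hp : ∀ a, 0 ≤ p a) {S : ℝ}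
    (hS : ∀ x ∈ X, ∀ a ∈ T, |s x a| ≤ S) {B : Type*} [MeasurableSpace B] {U : ℝ → B → ℝ}
    (hU : ∀ a ∈ T, Measurable (U a)) :
    Measurable fun b => downwardValue X u s p T fun a => U a b := by
  classical
  let e : (T → ℝ) → ℝ → ℝ := fun w a => if h : a ∈ T then w ⟨a, h⟩ else 0
  have hlip : LipschitzWith (∑ a ∈ T, p a).toNNReal fun w => downwardValue X u s p T (e w) := by
    refine LipschitzWith.of_dist_le_mul fun w w' => ?_
    rw [Real.coe_toNNReal _ (Finset.sum_nonneg fun a _ => hp a), mul_comm, Real.dist_eq]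
    refine abs_downwardValue_sub_le hX hp hS fun a ha => ?_
    simpa [e, ha, Real.dist_eq] using dist_le_pi_dist w w' ⟨a, ha⟩
  have hcomp : (fun b => downwardValue X u s p T fun a => U a b) =
      (fun w => downwardValue X u s p T (e w)) ∘ fun b (a : T) => U a b := by
    funext b
    apply le_antisymm <;> exact downwardValue_anti hX hp hS fun a ha => by simp [e, ha]
  rw [hcomp]
  exact hlip.continuous.measurable.comp (measurable_pi_lambda _ fun a => hU a a.2)

/-- Backward induction over the finitely many productive types: the payoff of a mechanism with
costly screening is bounded by the expected value of the downward-constrained problem in which the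
utilities are prescribed by the mechanism. -/
theorem sum_integral_le_integral_downwardValue (hX : X.Nonempty) (hp : ∀ a, 0 ≤ p a) {S C : ℝ}
    {B : Type*} [MeasurableSpace B] [Preorder B] {D : Set B} {x U : ℝ → B → ℝ} {ν : ℝ → Measure B}
    (T : Finset ℝ) (hS : ∀ x ∈ X, ∀ a ∈ T, |s x a| ≤ S)
    (hx : ∀ a ∈ T, ∀ b ∈ D, x a b ∈ X) (hUC : ∀ a ∈ T, ∀ b ∈ D, |U a b| ≤ C)
    (hU : ∀ a ∈ T, Measurable (U a)) (hsm : ∀ a ∈ T, Measurable fun b => s (x a b) a)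
    (hmono : ∀ a ∈ T, MonotoneOn (U a) D)
    (hIC : ∀ a ∈ T, ∀ a' ∈ T, a < a' → ∀ b ∈ D,
      U a b + (u (x a b) a' - u (x a b) a) ≤ U a' b)
    (hν : ∀ a ∈ T, 0 < p a → IsProbabilityMeasure (ν a) ∧ ∀ᵐ b ∂ν a, b ∈ D)
    (hdom : ∀ a ∈ T, 0 < p a → ∀ a' ∈ T, 0 < p a' → a < a' → ∀ f : B → ℝ, Measurable f →
      MonotoneOn f D → (∃ c, ∀ b ∈ D, |f b| ≤ c) → ∫ b, f b ∂ν a ≤ ∫ b, f b ∂ν a')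
    (ν₀ : Measure B) [IsProbabilityMeasure ν₀] (hν₀ : ∀ᵐ b ∂ν₀, b ∈ D)
    (hdom₀ : ∀ a ∈ T, 0 < p a → ∀ f : B → ℝ, Measurable f →
      MonotoneOn f D → (∃ c, ∀ b ∈ D, |f b| ≤ c) → ∫ b, f b ∂ν₀ ≤ ∫ b, f b ∂ν a) :
    ∑ a ∈ T, p a * ∫ b, (s (x a b) a - U a b) ∂ν a ≤
      ∫ b, downwardValue X u s p T (fun a => U a b) ∂ν₀ := by
  have hbdd : ∀ T' ⊆ T, ∃ c, ∀ b ∈ D, |downwardValue X u s p T' fun a => U a b| ≤ c := by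
    intro T' hT'
    exact ⟨_, fun b hb => abs_downwardValue_le hX hp (fun x hx a ha => hS x hx a (hT' ha))
      fun a ha => hUC a (hT' ha) b hb⟩
  have hmeas : ∀ T' ⊆ T, Measurable fun b => downwardValue X u s p T' fun a => U a b :=
    fun T' hT' => measurable_downwardValue hX hp (fun x hx a ha => hS x hx a (hT' ha))
      fun a ha => hU a (hT' ha)
  have hint : ∀ T' ⊆ T, ∀ (μ : Measure B) [IsProbabilityMeasure μ], (∀ᵐ b ∂μ, b ∈ D) →
      Integrable (fun b => downwardValue X u s p T' fun a => U a b) μ := by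
    intro T' hT' μ _ hμ
    obtain ⟨c, hc⟩ := hbdd T' hT'
    exact Integrable.of_bound (hmeas T' hT').aestronglyMeasurable c
      (hμ.mono fun b hb => by simpa using hc b hb)
  suffices H : ∀ T' : Finset ℝ, T' ⊆ T → ∀ (ν₀ : Measure B) [IsProbabilityMeasure ν₀],
      (∀ᵐ b ∂ν₀, b ∈ D) → (∀ a ∈ T', 0 < p a → ∀ f : B → ℝ, Measurable f →
      MonotoneOn f D → (∃ c, ∀ b ∈ D, |f b| ≤ c) → ∫ b, f b ∂ν₀ ≤ ∫ b, f b ∂ν a) →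
      ∑ a ∈ T', p a * ∫ b, (s (x a b) a - U a b) ∂ν a ≤
        ∫ b, downwardValue X u s p T' (fun a => U a b) ∂ν₀ from
    H T subset_rfl ν₀ hν₀ hdom₀
  intro T'
  induction T' using Finset.induction_on_min with
  | empty =>
    intro _ ν₀ _ _ _
    refine le_of_eq ?_
    have : ∀ w, downwardValue X u s p ∅ w = 0 := fun w => by
      have : downwardPayoffs X u s p ∅ w = {0} := by
        ext c
        simp [downwardPayoffs, DownwardFeasible]
      simp [downwardValue, this]
    simp [this]
  | insert a₀ T' ha₀ ih =>
    intro hsub ν₀ _ hν₀ hdom₀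
    have hT' : T' ⊆ T := (Finset.subset_insert _ _).trans hsub
    have ha₀T : a₀ ∈ T := hsub (Finset.mem_insert_self _ _)
    rw [Finset.sum_insert fun h => lt_irrefl _ (ha₀ _ h)]
    have hstep : ∀ b ∈ D, p a₀ * (s (x a₀ b) a₀ - U a₀ b) +
        downwardValue X u s p T' (fun a => U a b) ≤
        downwardValue X u s p (insert a₀ T') (fun a => U a b) := fun b hb =>
      add_downwardValue_le (w := fun a => U a b) hX hp (fun y hy a ha => hS y hy a (hsub ha)) ha₀
        (hx a₀ ha₀T b hb)
        fun a ha => hIC a₀ ha₀T a (hT' ha) (ha₀ a ha) b hb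
    rcases (hp a₀).eq_or_lt with h0 | hpos
    · rw [← h0, zero_mul, zero_add]
      refine (ih hT' ν₀ hν₀ fun a ha => hdom₀ a (Finset.mem_insert_of_mem ha)).trans ?_
      refine integral_mono_ae (hint T' hT' ν₀ hν₀) (hint _ hsub ν₀ hν₀) (hν₀.mono fun b hb => ?_)
      simpa [← h0] using hstep b hb
    · obtain ⟨hprob, hD⟩ := hν a₀ ha₀T hpos
      have h1 := ih hT' (ν a₀) hD fun a ha hpa =>
        hdom a₀ ha₀T hpos a (hT' ha) hpa (ha₀ a ha)
      have hsi : Integrable (fun b => s (x a₀ b) a₀ - U a₀ b) (ν a₀) := by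
        refine Integrable.of_bound ((hsm a₀ ha₀T).sub (hU a₀ ha₀T)).aestronglyMeasurable (S + C)
          (hD.mono fun b hb => ?_)
        rw [Real.norm_eq_abs]
        exact (abs_sub _ _).trans
          (add_le_add (hS _ (hx a₀ ha₀T b hb) a₀ ha₀T) (hUC a₀ ha₀T b hb))
      have h2 : p a₀ * ∫ b, (s (x a₀ b) a₀ - U a₀ b) ∂ν a₀ +
          ∫ b, downwardValue X u s p T' (fun a => U a b) ∂ν a₀ ≤
          ∫ b, downwardValue X u s p (insert a₀ T') (fun a => U a b) ∂ν a₀ := by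
        rw [← integral_const_mul, ← integral_add (hsi.const_mul _) (hint T' hT' _ hD)]
        exact integral_mono_ae ((hsi.const_mul _).add (hint T' hT' _ hD)) (hint _ hsub _ hD)
          (hD.mono fun b hb => hstep b hb)
      have h3 := hdom₀ a₀ (Finset.mem_insert_self _ _) hpos
        (fun b => - downwardValue X u s p (insert a₀ T') fun a => U a b) (hmeas _ hsub).neg
        (fun b hb b' hb' hbb => neg_le_neg (downwardValue_anti hX hp
          (fun y hy a ha => hS y hy a (hsub ha)) fun a ha => hmono a (hsub ha) hb hb' hbb))
        (by simpa using hbdd _ hsub)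
      rw [integral_neg, integral_neg] at h3
      linarith

end DownwardValue

open scoped Pointwise in
/-- In a finite-dimensional real space, the upper closure of a compact set is closed. -/
theorem IsCompact.isClosed_upperClosure_pi {ι : Type*} {K : Set (ι → ℝ)} (hK : IsCompact K) :
    IsClosed (upperClosure K : Set (ι → ℝ)) := by
  have h : (upperClosure K : Set (ι → ℝ)) = K + Ici (0 : ι → ℝ) := by
    ext b
    simp only [SetLike.mem_coe, mem_upperClosure, Set.mem_add, mem_Ici]
    constructor
    · rintro ⟨a, ha, hab⟩
      exact ⟨a, ha, b - a, sub_nonneg.2 hab, add_sub_cancel _ _⟩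
    · rintro ⟨a, ha, c, hc, rfl⟩
      exact ⟨a, ha, le_add_of_nonneg_right hc⟩
  rw [h]
  exact isClosed_Ici.add_left_of_isCompact hK

/-- Stochastic dominance tested on monotone functions on the whole space implies stochastic
dominance for functions that are monotone only on a set `D` carrying both measures. -/
theorem integral_le_integral_of_monotoneOn {ι : Type*} [Fintype ι] {μ ν : Measure (ι → ℝ)}
    [IsProbabilityMeasure μ] [IsProbabilityMeasure ν] {D : Set (ι → ℝ)} (hD : MeasurableSet D)
    (hμ : ∀ᵐ b ∂μ, b ∈ D) (hν : ∀ᵐ b ∂ν, b ∈ D)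
    (hdom : ∀ f : (ι → ℝ) → ℝ, Measurable f → Monotone f → (∃ M, ∀ b, |f b| ≤ M) →
      ∫ b, f b ∂μ ≤ ∫ b, f b ∂ν)
    {f : (ι → ℝ) → ℝ} (hf : Measurable f) (hmono : MonotoneOn f D)
    (hbdd : ∃ c, ∀ b ∈ D, |f b| ≤ c) :
    ∫ b, f b ∂μ ≤ ∫ b, f b ∂ν := by
  classical
  have hset : ∀ A : Set (ι → ℝ), MeasurableSet A → A ⊆ D →
      (∀ b ∈ A, ∀ b' ∈ D, b ≤ b' → b' ∈ A) → μ A ≤ ν A := by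
    intro A hA hAD hup
    refine le_of_forall_lt fun r hr => ?_
    obtain ⟨K, hKA, hK, hrK⟩ := hA.exists_lt_isCompact hr
    have hcl : MeasurableSet (upperClosure K : Set (ι → ℝ)) := hK.isClosed_upperClosure_pi.measurableSet
    have h1 := hdom ((upperClosure K : Set (ι → ℝ)).indicator 1) (measurable_one.indicator hcl)
      (fun b b' hbb => by
        by_cases hb : b ∈ (upperClosure K : Set (ι → ℝ))
        · have hb' := (upperClosure K).upper hbb hb
          simp only [indicator_of_mem hb, indicator_of_mem hb', le_refl, Pi.one_apply]
        · rw [indicator_of_notMem hb]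
          exact indicator_nonneg (fun _ _ => zero_le_one) _)
      ⟨1, fun b => by by_cases hb : b ∈ (upperClosure K : Set (ι → ℝ)) <;> simp [indicator, hb]⟩
    rw [integral_indicator_one hcl, integral_indicator_one hcl] at h1
    have h2 : μ (upperClosure K : Set (ι → ℝ)) ≤ ν (upperClosure K : Set (ι → ℝ)) :=
      (ENNReal.toReal_le_toReal (measure_ne_top _ _) (measure_ne_top _ _)).1 h1
    have h3 : ν (upperClosure K : Set (ι → ℝ)) ≤ ν A :=
      measure_mono_ae (hν.mono fun b hb hbK => by
        obtain ⟨k, hk, hkb⟩ := mem_upperClosure.1 hbK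
        exact hup k (hKA hk) b hb hkb)
    exact (hrK.trans_le (measure_mono subset_upperClosure)).trans_le (h2.trans h3)
  obtain ⟨c, hc⟩ := hbdd
  have hintg : ∀ (ρ : Measure (ι → ℝ)) [IsProbabilityMeasure ρ], (∀ᵐ b ∂ρ, b ∈ D) →
      Integrable f ρ := fun ρ _ hρ =>
    Integrable.of_bound hf.aestronglyMeasurable c (hρ.mono fun b hb => hc b hb)
  let g : (ι → ℝ) → ℝ := D.indicator fun b => f b + c
  have hg0 : ∀ b, 0 ≤ g b := fun b => indicator_nonneg (fun b hb => by
    linarith [(abs_le.1 (hc b hb)).1]) b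
  have hgm : Measurable g := (hf.add_const c).indicator hD
  have hgi : ∀ (ρ : Measure (ι → ℝ)) [IsProbabilityMeasure ρ], (∀ᵐ b ∂ρ, b ∈ D) →
      Integrable g ρ ∧ ∫ b, g b ∂ρ = ∫ b, f b ∂ρ + c := by
    intro ρ _ hρ
    have hae : g =ᵐ[ρ] fun b => f b + c := hρ.mono fun b hb => indicator_of_mem hb _
    have hi := (hintg ρ hρ).add (integrable_const c)
    refine ⟨hi.congr hae.symm, ?_⟩
    rw [integral_congr_ae hae, integral_add (hintg ρ hρ) (integrable_const c)]
    simp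
  have hlin : ∫⁻ b, ENNReal.ofReal (g b) ∂μ ≤ ∫⁻ b, ENNReal.ofReal (g b) ∂ν := by
    rw [lintegral_eq_lintegral_meas_lt μ (ae_of_all _ hg0) hgm.aemeasurable,
      lintegral_eq_lintegral_meas_lt ν (ae_of_all _ hg0) hgm.aemeasurable]
    refine setLIntegral_mono' measurableSet_Ioi fun t ht => hset _ (measurableSet_lt
      measurable_const hgm) (fun b hb => ?_) fun b hb b' hb' hbb => ?_
    · by_contra hbD
      have : g b = 0 := indicator_of_notMem hbD _
      have h : t < g b := hb
      exact absurd (mem_Ioi.1 ht) (by linarith)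
    · have h : t < g b := hb
      have hbD : b ∈ D := by
        by_contra hbD
        have : g b = 0 := indicator_of_notMem hbD _
        exact absurd (mem_Ioi.1 ht) (by linarith)
      have e1 : g b = f b + c := indicator_of_mem hbD _
      have e2 : g b' = f b' + c := indicator_of_mem hb' _
      have := hmono hbD hb' hbb
      change t < g b'
      linarith
  obtain ⟨i1, e1⟩ := hgi μ hμ
  obtain ⟨i2, e2⟩ := hgi ν hν
  have : ∫ b, g b ∂μ ≤ ∫ b, g b ∂ν := by
    rw [← ofReal_integral_eq_lintegral_ofReal i1 (ae_of_all _ hg0),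
      ← ofReal_integral_eq_lintegral_ofReal i2 (ae_of_all _ hg0)] at hlin
    exact (ENNReal.ofReal_le_ofReal_iff (integral_nonneg hg0)).1 hlin
  linarith

open Filter Topology in
/-- **Helly's selection theorem** for uniformly bounded monotone functions. -/
theorem exists_subseq_tendsto_of_monotone {A B : ℝ} {F : ℕ → ℝ → ℝ} (hF : ∀ n, Monotone (F n))
    (hAB : ∀ n a, F n a ∈ Icc A B) :
    ∃ φ : ℕ → ℕ, StrictMono φ ∧ ∃ G : ℝ → ℝ, Monotone G ∧
      ∀ a, Tendsto (fun n => F (φ n) a) atTop (𝓝 (G a)) := by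
  have hcomp : IsCompact (Set.univ.pi fun _ : ℝ => Icc A B) := isCompact_univ_pi fun _ => isCompact_Icc
  obtain ⟨G, -, hG⟩ := hcomp (f := map F atTop) (by
    rw [le_principal_iff]
    exact Filter.eventually_map.2 (Eventually.of_forall fun n a _ => hAB n a))
  have hcl : MapClusterPt G atTop F := hG
  have hGm : Monotone G := by
    intro a b hab
    have hclosed : IsClosed {f : ℝ → ℝ | f a ≤ f b} :=
      isClosed_le (continuous_apply a) (continuous_apply b)
    exact hclosed.mem_of_mapClusterPt hcl (Eventually.of_forall fun n => hF n hab)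
  let Q : Set ℝ := {a | ¬ ContinuousAt G a} ∪ range ((↑) : ℚ → ℝ)
  have hQ : Q.Countable := hGm.countable_not_continuousAt.union (countable_range _)
  have : Countable Q := hQ.to_subtype
  have hclQ : MapClusterPt (fun q : Q => G q) atTop fun n (q : Q) => F n q :=
    hcl.continuousAt_comp (f := fun (f : ℝ → ℝ) (q : Q) => f q)
      (by fun_prop : Continuous _).continuousAt
  obtain ⟨φ, hφ, hlim⟩ := hclQ.tendsto_subseq
  have hlimQ : ∀ a ∈ Q, Tendsto (fun n => F (φ n) a) atTop (𝓝 (G a)) := fun a ha =>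
    (tendsto_pi_nhds.1 hlim ⟨a, ha⟩)
  refine ⟨φ, hφ, G, hGm, fun a => ?_⟩
  by_cases hc : ContinuousAt G a
  · rw [tendsto_order]
    constructor
    · intro c hcG
      obtain ⟨δ, hδ, hball⟩ := Metric.eventually_nhds_iff.1 (hc.eventually (lt_mem_nhds hcG))
      obtain ⟨q, hq1, hq2⟩ := exists_rat_btwn (sub_lt_self a hδ)
      have hq : c < G q := hball (by rw [Real.dist_eq, abs_lt]; constructor <;> linarith)
      filter_upwards [(hlimQ q (Or.inr ⟨q, rfl⟩)).eventually (lt_mem_nhds hq)] with n hn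
      exact hn.trans_le (hF _ hq2.le)
    · intro c hcG
      obtain ⟨δ, hδ, hball⟩ := Metric.eventually_nhds_iff.1 (hc.eventually (gt_mem_nhds hcG))
      obtain ⟨q, hq1, hq2⟩ := exists_rat_btwn (lt_add_of_pos_right a hδ)
      have hq : G q < c := hball (by rw [Real.dist_eq, abs_lt]; constructor <;> linarith)
      filter_upwards [(hlimQ q (Or.inr ⟨q, rfl⟩)).eventually (gt_mem_nhds hq)] with n hn
      exact (hF _ hq1.le).trans_lt hn
  · exact hlimQ a (Or.inl hc)

open Filter Topology in
/-- Helly's selection theorem on a subset of the line. -/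
theorem exists_subseq_tendsto_of_monotoneOn {A B : ℝ} {s : Set ℝ} (hne : s.Nonempty)
    {F : ℕ → ℝ → ℝ} (hF : ∀ n, MonotoneOn (F n) s) (hAB : ∀ n, ∀ a ∈ s, F n a ∈ Icc A B) :
    ∃ φ : ℕ → ℕ, StrictMono φ ∧ ∃ G : ℝ → ℝ, Monotone G ∧
      ∀ a ∈ s, Tendsto (fun n => F (φ n) a) atTop (𝓝 (G a)) := by
  have hle : A ≤ B := by
    obtain ⟨a, ha⟩ := hne
    exact (hAB 0 a ha).1.trans (hAB 0 a ha).2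
  have hext : ∀ n, ∃ g : ℝ → ℝ, Monotone g ∧ (∀ a, g a ∈ Icc A B) ∧ EqOn (F n) g s := by
    intro n
    obtain ⟨g, hg, hgs⟩ := (hF n).exists_monotone_extension
      ⟨A, by rintro _ ⟨a, ha, rfl⟩; exact (hAB n a ha).1⟩
      ⟨B, by rintro _ ⟨a, ha, rfl⟩; exact (hAB n a ha).2⟩
    refine ⟨fun a => projIcc A B hle (g a), fun a b hab => monotone_projIcc hle (hg hab),
      fun a => (projIcc A B hle (g a)).2, fun a ha => ?_⟩
    have h : g a ∈ Icc A B := hgs ha ▸ hAB n a ha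
    simp only [projIcc_of_mem hle h]
    exact hgs ha
  choose g hg hgI hgs using hext
  obtain ⟨φ, hφ, G, hG, hlim⟩ := exists_subseq_tendsto_of_monotone hg hgI
  exact ⟨φ, hφ, G, hG, fun a ha => (hlim a).congr fun n => (hgs (φ n) ha).symm⟩

/-- Discretization of a probability measure carried by a compact set of reals: the line is cut into
cells of length `ε`, each charged cell is represented by a point of `G` at which the integrand is at
least its average over the cell, and `r` sends a point to the representative of its cell. -/
theorem exists_discretization {μ : Measure ℝ} [IsProbabilityMeasure μ] {K G : Set ℝ}
    (hK : IsCompact K) (hKμ : ∀ᵐ a ∂μ, a ∈ K) (hGμ : ∀ᵐ a ∂μ, a ∈ G) {π : ℝ → ℝ}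
    (hπ : Integrable π μ) {ε : ℝ} (hε : 0 < ε) :
    ∃ (T : Finset ℝ) (p r : ℝ → ℝ), T.Nonempty ∧ (T : Set ℝ) ⊆ K ∧ (∀ a, 0 ≤ p a) ∧
      (∀ a ∈ T, 0 < p a → a ∈ G) ∧ MonotoneOn r K ∧ (∀ a ∈ K, r a ∈ T ∧ |r a - a| ≤ ε) ∧
      (∀ ψ : ℝ → ℝ, Measurable fun a => ψ (r a)) ∧
      (∀ ψ : ℝ → ℝ, ∫ a, ψ (r a) ∂μ = ∑ a ∈ T, p a * ψ a) ∧
      ∫ a, π a ∂μ ≤ ∑ a ∈ T, p a * π a := by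
  classical
  let q : ℝ → ℤ := fun a => ⌊a / ε⌋
  have hq : Measurable q := (measurable_id.div_const ε).floor
  have hqm : Monotone q := fun a b hab => Int.floor_mono (div_le_div_of_nonneg_right hab hε.le)
  have hcell : ∀ m, MeasurableSet (q ⁻¹' {m}) := fun m => hq (measurableSet_singleton m)
  have hrep : ∀ m : ℤ, ∃ c, ((∃ a ∈ K, q a = m) → c ∈ K ∧ q c = m) ∧
      (0 < μ.real (q ⁻¹' {m}) → c ∈ G) ∧
      ∫ a in q ⁻¹' {m}, π a ∂μ ≤ μ.real (q ⁻¹' {m}) * π c := by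
    intro m
    rcases (measureReal_nonneg (μ := μ) (s := q ⁻¹' {m})).eq_or_lt with h0 | hpos
    · have hz : μ (q ⁻¹' {m}) = 0 := by
        rwa [eq_comm, measureReal_eq_zero_iff] at h0
      by_cases hm : ∃ a ∈ K, q a = m
      · obtain ⟨a, ha⟩ := hm
        exact ⟨a, fun _ => ha, fun h => absurd h (by simp [← h0]),
          by simp [← h0, Measure.restrict_eq_zero.2 hz]⟩
      · exact ⟨0, fun h => absurd h hm, fun h => absurd h (by simp [← h0]),
          by simp [← h0, Measure.restrict_eq_zero.2 hz]⟩
    · have hne : μ.restrict (q ⁻¹' {m}) ≠ 0 := fun h => by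
        rw [Measure.restrict_eq_zero] at h
        simp [measureReal_def, h] at hpos
      have hae : ∀ᵐ a ∂μ.restrict (q ⁻¹' {m}), a ∈ K ∧ a ∈ G ∧ q a = m := by
        filter_upwards [ae_restrict_of_ae hKμ, ae_restrict_of_ae hGμ, ae_restrict_mem (hcell m)]
          with a h1 h2 h3 using ⟨h1, h2, h3⟩
      obtain ⟨c, hc, hle⟩ := exists_notMem_null_average_le hne hπ.integrableOn hae
      have hc' : c ∈ K ∧ c ∈ G ∧ q c = m := by
        by_contra h
        exact hc h
      refine ⟨c, fun _ => ⟨hc'.1, hc'.2.2⟩, fun _ => hc'.2.1, ?_⟩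
      rw [setAverage_eq, smul_eq_mul, inv_mul_le_iff₀ hpos] at hle
      exact hle
  choose c hcK hcG hcπ using hrep
  have hfin : (q '' K).Finite := by
    obtain ⟨A, hA⟩ := hK.bddBelow
    obtain ⟨B, hB⟩ := hK.bddAbove
    refine (Set.finite_Icc (q A) (q B)).subset ?_
    rintro _ ⟨a, ha, rfl⟩
    exact ⟨hqm (hA ha), hqm (hB ha)⟩
  let I : Finset ℤ := hfin.toFinset
  have hI : ∀ m ∈ I, ∃ a ∈ K, q a = m := fun m hm => by simpa [I] using hm
  have hKI : ∀ a ∈ K, q a ∈ I := fun a ha => by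
    simpa [I] using ⟨a, ha, rfl⟩
  have hqc : ∀ m ∈ I, q (c m) = m := fun m hm => (hcK m (hI m hm)).2
  have hinj : Set.InjOn c I := fun m hm m' hm' h => by
    rw [← hqc m hm, ← hqc m' hm', h]
  have hsplit : ∀ ψ : ℝ → ℝ, Integrable ψ μ →
      ∫ a, ψ a ∂μ = ∑ m ∈ I, ∫ a in q ⁻¹' {m}, ψ a ∂μ := by
    intro ψ hψ
    rw [← integral_biUnion_finset I (fun m _ => hcell m)
      (fun m _ m' _ hmm => (Set.disjoint_singleton.2 hmm).preimage q) fun m _ => hψ.integrableOn]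
    rw [setIntegral_eq_integral_of_ae_compl_eq_zero]
    filter_upwards [hKμ] with a ha hna
    exact absurd (Set.mem_iUnion₂.2 ⟨q a, hKI a ha, rfl⟩) hna
  have hsum : ∀ ψ : ℝ → ℝ, ∑ a ∈ I.image c, μ.real (q ⁻¹' {q a}) * ψ a =
      ∑ m ∈ I, μ.real (q ⁻¹' {m}) * ψ (c m) := fun ψ => by
    rw [Finset.sum_image hinj]
    exact Finset.sum_congr rfl fun m hm => by rw [hqc m hm]
  have hKne : K.Nonempty := hKμ.exists
  refine ⟨I.image c, fun a => μ.real (q ⁻¹' {q a}), fun a => c (q a), ?_, ?_, fun a =>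
    measureReal_nonneg, ?_, ?_, fun a ha => ⟨Finset.mem_image_of_mem c (hKI a ha), ?_⟩, ?_, ?_, ?_⟩
  · obtain ⟨a, ha⟩ := hKne
    exact ⟨c (q a), Finset.mem_image_of_mem c (hKI a ha)⟩
  · intro a ha
    obtain ⟨m, hm, rfl⟩ := Finset.mem_image.1 (Finset.mem_coe.1 ha)
    exact (hcK m (hI m hm)).1
  · intro a ha hpos
    obtain ⟨m, hm, rfl⟩ := Finset.mem_image.1 ha
    beta_reduce at hpos
    rw [hqc m hm] at hpos
    exact hcG m hpos
  · intro a ha b hb hab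
    rcases (hqm hab).eq_or_lt with h | h
    · exact le_of_eq (congrArg c h)
    · by_contra! hlt
      have := hqm hlt.le
      rw [hqc _ (hKI a ha), hqc _ (hKI b hb)] at this
      exact absurd h this.not_gt
  · have h : ⌊c (q a) / ε⌋ = ⌊a / ε⌋ := hqc _ (hKI a ha)
    have h2 := Int.abs_sub_lt_one_of_floor_eq_floor h
    rw [← sub_div, abs_div, abs_of_pos hε, div_lt_one hε] at h2
    exact h2.le
  · intro ψ
    exact (measurable_from_top (f := fun m => ψ (c m))).comp hq
  · intro ψ
    have hmeas : Measurable fun a => ψ (c (q a)) :=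
      (measurable_from_top (f := fun m => ψ (c m))).comp hq
    obtain ⟨C, hC⟩ : ∃ C, ∀ m ∈ I, |ψ (c m)| ≤ C :=
      (I.image fun m => |ψ (c m)|).bddAbove.imp fun C hC m hm =>
        hC (Finset.mem_coe.2 (Finset.mem_image_of_mem _ hm))
    rw [hsplit _ (Integrable.of_bound hmeas.aestronglyMeasurable C
      (hKμ.mono fun a ha => hC _ (hKI a ha)))]
    refine Eq.trans (Finset.sum_congr rfl fun m _ => ?_) (hsum ψ).symm
    rw [setIntegral_congr_fun (hcell m) (g := fun _ => ψ (c m)) fun a ha => by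
      have : q a = m := ha
      simp only [this]]
    simp
  · rw [hsplit π hπ]
    exact (Finset.sum_le_sum fun m _ => hcπ m).trans_eq (hsum π).symm

/-- Finite approximation: up to `ε`, a mechanism with costly screening is outperformed by one that
screens the productive type only, and in which productive types are rounded by `r`. -/
theorem exists_monotone_approximation {ι : Type*} [Fintype ι] {ΘA X : Set ℝ} {D : Set (ι → ℝ)}
    (hΘA : IsCompact ΘA) (hX : IsCompact X) (hXne : X.Nonempty) (hD : MeasurableSet D)
    {u s : ℝ → ℝ → ℝ} (hu : Continuous fun z : ℝ × ℝ => u z.1 z.2)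
    (hs : Continuous fun z : ℝ × ℝ => s z.1 z.2) {M S : ℝ}
    (hM : ∀ x ∈ X, ∀ a ∈ ΘA, |u x a| ≤ M) (hS : ∀ x ∈ X, ∀ a ∈ ΘA, |s x a| ≤ S)
    (hmono : ∀ x ∈ X, ∀ a ∈ ΘA, ∀ a' ∈ ΘA, a ≤ a' → u x a ≤ u x a')
    (hid : ∀ x ∈ X, ∀ x' ∈ X, x < x' → ∀ a ∈ ΘA, ∀ a' ∈ ΘA, a < a' →
      u x' a - u x a < u x' a' - u x a')
    (hsc : ∀ x ∈ X, ∀ x' ∈ X, x < x' → ∀ a ∈ ΘA, ∀ a' ∈ ΘA, a < a' →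
      0 < s x' a - s x a → 0 < s x' a' - s x a')
    {μ : Measure ℝ} [IsProbabilityMeasure μ] {κ : Kernel ℝ (ι → ℝ)} [IsMarkovKernel κ]
    {G : Set ℝ} (hμΘ : ∀ᵐ a ∂μ, a ∈ ΘA) (hμG : ∀ᵐ a ∂μ, a ∈ G)
    (hGD : ∀ a ∈ G, ∀ᵐ b ∂κ a, b ∈ D)
    (hdom : ∀ a ∈ G, ∀ a' ∈ G, a < a' → ∀ f : (ι → ℝ) → ℝ, Measurable f → Monotone f →
      (∃ M, ∀ b, |f b| ≤ M) → ∫ b, f b ∂κ a ≤ ∫ b, f b ∂κ a')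
    {x U : ℝ × (ι → ℝ) → ℝ} (hx : Measurable x) (hU : Measurable U) {C : ℝ}
    (hxX : ∀ θ ∈ ΘA ×ˢ D, x θ ∈ X) (hU0 : ∀ θ ∈ ΘA ×ˢ D, 0 ≤ U θ) (hUC : ∀ θ ∈ ΘA ×ˢ D, U θ ≤ C)
    (hUm : ∀ a ∈ ΘA, MonotoneOn (fun b => U (a, b)) D)
    (hIC : ∀ a ∈ ΘA, ∀ a' ∈ ΘA, ∀ b ∈ D, U (a, b) + (u (x (a, b)) a' - u (x (a, b)) a) ≤ U (a', b))
    {ε : ℝ} (hε : 0 < ε) :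
    ∃ r f g : ℝ → ℝ, MonotoneOn f ΘA ∧ MonotoneOn g ΘA ∧
      (∀ a ∈ ΘA, f a ∈ X ∧ 0 ≤ g a ∧ g a ≤ 2 * M ∧ r a ∈ ΘA ∧ |r a - a| ≤ ε) ∧
      (∀ a ∈ ΘA, ∀ a' ∈ ΘA, g a + (u (f a) (r a') - u (f a) (r a)) ≤ g a') ∧
      (Measurable fun a => s (f a) (r a) - g a) ∧
      ∫ a, ∫ b, (s (x (a, b)) a - U (a, b)) ∂κ a ∂μ ≤ ∫ a, (s (f a) (r a) - g a) ∂μ + ε := by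
  classical
  have hbound : ∀ a ∈ ΘA, ∀ b ∈ D, |s (x (a, b)) a - U (a, b)| ≤ S + C := fun a ha b hb => by
    have h1 := hS _ (hxX (a, b) ⟨ha, hb⟩) a ha
    have h2 : |U (a, b)| ≤ C := by
      rw [abs_of_nonneg (hU0 (a, b) ⟨ha, hb⟩)]
      exact hUC (a, b) ⟨ha, hb⟩
    exact (abs_sub _ _).trans (add_le_add h1 h2)
  have hhm : Measurable fun θ : ℝ × (ι → ℝ) => s (x θ) θ.1 - U θ :=
    (hs.measurable.comp (hx.prodMk measurable_fst)).sub hU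
  have hπ : Integrable (fun a => ∫ b, (s (x (a, b)) a - U (a, b)) ∂κ a) μ := by
    refine Integrable.of_bound (C := S + C) ?_ ?_
    · exact (hhm.stronglyMeasurable.integral_kernel_prod_right' (κ := κ)).aestronglyMeasurable
    · filter_upwards [hμΘ, hμG] with a ha haG
      have h := norm_integral_le_of_norm_le_const (μ := κ a) (C := S + C)
        (f := fun b => s (x (a, b)) a - U (a, b))
        ((hGD a haG).mono fun b hb => hbound a ha b hb)
      simpa using h
  obtain ⟨T, p, r, hTne, hTΘ, hp, hTG, hrm, hr, hψm, hψ, hπT⟩ :=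
    exists_discretization hΘA hμΘ hμG hπ hε
  have hp1 : ∑ a ∈ T, p a = 1 := by
    have := hψ fun _ => 1
    simpa using this.symm
  have hST : ∀ y ∈ X, ∀ a ∈ T, |s y a| ≤ S := fun y hy a ha => hS y hy a (hTΘ ha)
  obtain ⟨a₁, ha₁, hmin⟩ : ∃ a₁ ∈ T.filter (0 < p ·), ∀ a ∈ T.filter (0 < p ·), a₁ ≤ a := by
    refine Finset.exists_min_image _ id ?_
    by_contra! hemp
    have : ∑ a ∈ T, p a = 0 := Finset.sum_eq_zero fun a ha => le_antisymm (not_lt.1 fun h => by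
      have : a ∈ T.filter (0 < p ·) := Finset.mem_filter.2 ⟨ha, h⟩
      simp [hemp] at this) (hp a)
    linarith
  rw [Finset.mem_filter] at ha₁
  have ha₁G := hTG a₁ ha₁.1 ha₁.2
  have hdomD : ∀ a ∈ G, ∀ a' ∈ G, a < a' → ∀ f : (ι → ℝ) → ℝ, Measurable f → MonotoneOn f D →
      (∃ c, ∀ b ∈ D, |f b| ≤ c) → ∫ b, f b ∂κ a ≤ ∫ b, f b ∂κ a' :=
    fun a ha a' ha' haa f hf hfm hfb => integral_le_integral_of_monotoneOn hD (hGD a ha)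
      (hGD a' ha') (hdom a ha a' ha' haa) hf hfm hfb
  have hUabs : ∀ a ∈ T, ∀ b ∈ D, |U (a, b)| ≤ C := fun a ha b hb => by
    rw [abs_of_nonneg (hU0 (a, b) ⟨hTΘ ha, hb⟩)]
    exact hUC (a, b) ⟨hTΘ ha, hb⟩
  have hDP := sum_integral_le_integral_downwardValue (u := u) (s := s) (p := p) (S := S) (C := C)
    (D := D) (x := fun a b => x (a, b)) (U := fun a b => U (a, b)) (ν := fun a => κ a) hXne hp T
    hST (fun a ha b hb => hxX (a, b) ⟨hTΘ ha, hb⟩) hUabs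
    (fun a _ => hU.comp measurable_prodMk_left)
    (fun a _ => (hs.comp (by fun_prop : Continuous fun y : ℝ => (y, a))).measurable.comp
      (hx.comp measurable_prodMk_left))
    (fun a ha => hUm a (hTΘ ha))
    (fun a ha a' ha' _ b hb => hIC a (hTΘ ha) a' (hTΘ ha') b hb)
    (fun a ha hpa => ⟨inferInstance, hGD a (hTG a ha hpa)⟩)
    (fun a ha hpa a' ha' hpa' haa => hdomD a (hTG a ha hpa) a' (hTG a' ha' hpa') haa)
    (κ a₁) (hGD a₁ ha₁G)
    (fun a ha hpa f hf hfm hfb => by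
      rcases (hmin a (Finset.mem_filter.2 ⟨ha, hpa⟩)).eq_or_lt with rfl | hlt
      · exact le_rfl
      · exact hdomD a₁ ha₁G a (hTG a ha hpa) hlt f hf hfm hfb)
  have hV : ∫ b, downwardValue X u s p T (fun a => U (a, b)) ∂κ a₁ ≤
      downwardValue X u s p T 0 := by
    have hi : Integrable (fun b => downwardValue X u s p T fun a => U (a, b)) (κ a₁) :=
      Integrable.of_bound (measurable_downwardValue hXne hp hST
        (U := fun a b => U (a, b)) fun a _ => hU.comp measurable_prodMk_left).aestronglyMeasurable
        (|downwardValue X u s p T 0| + C * ∑ a ∈ T, p a)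
        ((hGD a₁ ha₁G).mono fun b hb =>
          abs_downwardValue_le hXne hp hST fun a ha => hUabs a ha b hb)
    have := integral_mono_ae hi (integrable_const (downwardValue X u s p T 0))
      ((hGD a₁ ha₁G).mono fun b hb => downwardValue_anti hXne hp hST
        fun a ha => hU0 (a, b) ⟨hTΘ ha, hb⟩)
    simpa using this
  obtain ⟨_, ⟨x₀, U₀, hfeas, rfl⟩, hlt⟩ := exists_lt_of_lt_csSup
    (downwardPayoffs_nonempty (u := u) (s := s) (p := p) (T := T) hXne 0)
    (sub_lt_self (downwardValue X u s p T 0) hε)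
  have : Nonempty T := hTne.to_subtype
  obtain ⟨x₁, U₁, hx₁m, hU₁m, hx₁X, hU₁0, hU₁M, hIC₁, hle⟩ := exists_monotone_of_downwardIC
    (a := ((↑) : T → ℝ)) (u := u) (s := s) (M := M) (p := fun a => p a) (x₀ := fun a => x₀ a)
    (U₀ := fun a => U₀ a) hX
    (fun i => hu.comp (by fun_prop : Continuous fun y : ℝ => (y, (i : ℝ))))
    (fun i => hs.comp (by fun_prop : Continuous fun y : ℝ => (y, (i : ℝ))))
    (fun y hy i => hM y hy i (hTΘ i.2))
    (fun y hy i j hij => hmono y hy i (hTΘ i.2) j (hTΘ j.2) hij)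
    (fun y hy y' hy' hyy i j hij => hid y hy y' hy' hyy i (hTΘ i.2) j (hTΘ j.2) hij)
    (fun y hy y' hy' hyy i j hij => hsc y hy y' hy' hyy i (hTΘ i.2) j (hTΘ j.2) hij)
    (fun i => hp i) (fun i => (hfeas.1 i i.2).1) (fun i => (hfeas.1 i i.2).2)
    (fun i j hij => hfeas.2 i i.2 j j.2 hij)
  let F : ℝ → ℝ := fun a => if h : a ∈ T then x₁ ⟨a, h⟩ else 0
  let W : ℝ → ℝ := fun a => if h : a ∈ T then U₁ ⟨a, h⟩ else 0
  have hF : ∀ i : T, F i = x₁ i := fun i => by simp [F]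
  have hW : ∀ i : T, W i = U₁ i := fun i => by simp [W]
  have hF' : ∀ a (h : a ∈ T), F a = x₁ ⟨a, h⟩ := fun a h => hF ⟨a, h⟩
  have hW' : ∀ a (h : a ∈ T), W a = U₁ ⟨a, h⟩ := fun a h => hW ⟨a, h⟩
  refine ⟨r, fun a => F (r a), fun a => W (r a), ?_, ?_, ?_, ?_,
    hψm fun a => s (F a) a - W a, ?_⟩
  · intro a ha b hb hab
    simp only [hF' _ (hr a ha).1, hF' _ (hr b hb).1]
    exact hx₁m (hrm ha hb hab)
  · intro a ha b hb hab
    simp only [hW' _ (hr a ha).1, hW' _ (hr b hb).1]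
    exact hU₁m (hrm ha hb hab)
  · intro a ha
    simp only [hF' _ (hr a ha).1, hW' _ (hr a ha).1]
    exact ⟨hx₁X _, hU₁0 _, hU₁M _, hTΘ (hr a ha).1, (hr a ha).2⟩
  · intro a ha b hb
    simp only [hF' _ (hr a ha).1, hW' _ (hr a ha).1, hW' _ (hr b hb).1]
    exact hIC₁ ⟨r a, (hr a ha).1⟩ ⟨r b, (hr b hb).1⟩
  · rw [hψ fun a => s (F a) a - W a]
    rw [← Finset.sum_coe_sort T fun a => p a * (s (x₀ a) a - U₀ a)] at hlt
    rw [← Finset.sum_coe_sort T fun a => p a * (s (F a) a - W a)]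
    simp only [hF, hW]
    linarith

open Filter Topology in
/-- Passing to the limit in finite approximations, by Helly's selection theorem. -/
theorem exists_monotone_limit {ΘA X : Set ℝ} (hX : IsCompact X) {u s : ℝ → ℝ → ℝ}
    (hu : Continuous fun z : ℝ × ℝ => u z.1 z.2) (hs : Continuous fun z : ℝ × ℝ => s z.1 z.2)
    {C S : ℝ} (hS : ∀ x ∈ X, ∀ a ∈ ΘA, |s x a| ≤ S) {μ : Measure ℝ} [IsProbabilityMeasure μ]
    (hμΘ : ∀ᵐ a ∂μ, a ∈ ΘA) {c : ℝ}
    (h : ∀ ε > 0, ∃ r f g : ℝ → ℝ, MonotoneOn f ΘA ∧ MonotoneOn g ΘA ∧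
      (∀ a ∈ ΘA, f a ∈ X ∧ 0 ≤ g a ∧ g a ≤ C ∧ r a ∈ ΘA ∧ |r a - a| ≤ ε) ∧
      (∀ a ∈ ΘA, ∀ a' ∈ ΘA, g a + (u (f a) (r a') - u (f a) (r a)) ≤ g a') ∧
      (Measurable fun a => s (f a) (r a) - g a) ∧
      c ≤ ∫ a, (s (f a) (r a) - g a) ∂μ + ε) :
    ∃ f g : ℝ → ℝ, Monotone f ∧ Monotone g ∧
      (∀ a ∈ ΘA, f a ∈ X ∧ 0 ≤ g a ∧ g a ≤ C) ∧
      (∀ a ∈ ΘA, ∀ a' ∈ ΘA, g a + (u (f a) a' - u (f a) a) ≤ g a') ∧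
      c ≤ ∫ a, (s (f a) a - g a) ∂μ := by
  choose r f g hfm hgm hfg hIC hmeas hc using fun n : ℕ =>
    h (1 / ((n : ℝ) + 1)) Nat.one_div_pos_of_nat
  have hne : ΘA.Nonempty := hμΘ.exists
  obtain ⟨A, hA⟩ := hX.bddBelow
  obtain ⟨B, hB⟩ := hX.bddAbove
  obtain ⟨φ, hφ, F, hF, hFlim⟩ := exists_subseq_tendsto_of_monotoneOn hne hfm
    fun n a ha => ⟨hA (hfg n a ha).1, hB (hfg n a ha).1⟩
  obtain ⟨ψ, hψ, W, hW, hWlim⟩ := exists_subseq_tendsto_of_monotoneOn hne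
    (fun n => hgm (φ n)) fun n a ha => ⟨(hfg (φ n) a ha).2.1, (hfg (φ n) a ha).2.2.1⟩
  have hsub : Tendsto (fun n => φ (ψ n)) atTop atTop :=
    hφ.tendsto_atTop.comp hψ.tendsto_atTop
  have hε : Tendsto (fun n => 1 / ((φ (ψ n) : ℝ) + 1)) atTop (𝓝 0) :=
    tendsto_one_div_add_atTop_nhds_zero_nat.comp hsub
  have hflim : ∀ a ∈ ΘA, Tendsto (fun n => f (φ (ψ n)) a) atTop (𝓝 (F a)) := fun a ha =>
    (hFlim a ha).comp hψ.tendsto_atTop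
  have hrlim : ∀ a ∈ ΘA, Tendsto (fun n => r (φ (ψ n)) a) atTop (𝓝 a) := fun a ha => by
    rw [tendsto_iff_dist_tendsto_zero]
    exact squeeze_zero (fun _ => dist_nonneg) (fun n => (hfg (φ (ψ n)) a ha).2.2.2.2) hε
  have hulim : ∀ v : ℝ → ℝ → ℝ, (Continuous fun z : ℝ × ℝ => v z.1 z.2) → ∀ a ∈ ΘA, ∀ a' ∈ ΘA,
      Tendsto (fun n => v (f (φ (ψ n)) a) (r (φ (ψ n)) a')) atTop (𝓝 (v (F a) a')) :=
    fun v hv a ha a' ha' => (hv.tendsto (F a, a')).comp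
      ((hflim a ha).prodMk_nhds (hrlim a' ha'))
  have hint : Tendsto (fun n => ∫ a, (s (f (φ (ψ n)) a) (r (φ (ψ n)) a) - g (φ (ψ n)) a) ∂μ)
      atTop (𝓝 (∫ a, (s (F a) a - W a) ∂μ)) := by
    refine tendsto_integral_of_dominated_convergence (fun _ => S + C)
      (fun n => (hmeas _).aestronglyMeasurable) (integrable_const _) (fun n => ?_) ?_
    · filter_upwards [hμΘ] with a ha
      obtain ⟨h1, h2, h3, h4, -⟩ := hfg (φ (ψ n)) a ha
      rw [Real.norm_eq_abs]
      refine (abs_sub _ _).trans (add_le_add (hS _ h1 _ h4) ?_)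
      rwa [abs_of_nonneg h2]
    · filter_upwards [hμΘ] with a ha
      exact (hulim s hs a ha a ha).sub (hWlim a ha)
  refine ⟨F, W, hF, hW, fun a ha => ⟨?_, ?_, ?_⟩, fun a ha a' ha' => ?_, ?_⟩
  · exact hX.isClosed.mem_of_tendsto (hflim a ha) (Eventually.of_forall fun n => (hfg _ a ha).1)
  · exact ge_of_tendsto' (hWlim a ha) fun n => (hfg _ a ha).2.1
  · exact le_of_tendsto' (hWlim a ha) fun n => (hfg _ a ha).2.2.1
  · exact le_of_tendsto_of_tendsto' ((hWlim a ha).add ((hulim u hu a ha a' ha').sub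
      (hulim u hu a ha a ha))) (hWlim a' ha') fun n => hIC _ a ha a' ha'
  · simpa using ge_of_tendsto' (hint.add hε) fun n => hc (φ (ψ n))

theorem ae_mem_msupport (μ : Measure ℝ) : ∀ᵐ a ∂μ, a ∈ MSupport μ := by
  filter_upwards [Measure.support_mem_ae (μ := μ)] with a ha U hU haU
  exact (Measure.mem_support_iff_forall a).1 ha U (hU.mem_nhds haU)

theorem IsRCD.eq_compProd {A B : Type*} [MeasurableSpace A] [MeasurableSpace B]
    {γ : Measure (A × B)} [IsFiniteMeasure γ] {κ : Kernel A B} (h : IsRCD γ κ) :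
    γ = γ.fst ⊗ₘ κ := by
  have := h.1
  ext s hs
  rw [Measure.compProd_apply hs, h.2 s hs]
  rfl

theorem Mechanism.congr {ΘA X : Set ℝ} {ΘB : Set (Fin N → ℝ)} {uA uA' : ℝ → ℝ → ℝ}
    {uB : Y → (Fin N → ℝ) → ℝ} {γ : Measure (ℝ × (Fin N → ℝ))} {x : ℝ × (Fin N → ℝ) → ℝ}
    {y : ℝ × (Fin N → ℝ) → Y} {t : ℝ × (Fin N → ℝ) → ℝ}
    (h : ∀ z ∈ X, ∀ a ∈ ΘA, uA z a = uA' z a) (hm : Mechanism ΘA ΘB X uA uB γ x y t) :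
    Mechanism ΘA ΘB X uA' uB γ x y t := by
  obtain ⟨h1, h2, h3, h4, h5, h6, h7⟩ := hm
  refine ⟨h1, h2, h3, h4, h5, fun θ hθ θ' hθ' => ?_, fun θ hθ => ?_⟩
  · rw [← h _ (h5 θ hθ) _ hθ.1, ← h _ (h5 θ' hθ') _ hθ.1]
    exact h6 θ hθ θ' hθ'
  · rw [← h _ (h5 θ hθ) _ hθ.1]
    exact h7 θ hθ

section ContinuousUtilities

variable {ΘA X : Set ℝ} {ΘB : Set (Fin N → ℝ)} {γ : Measure (ℝ × (Fin N → ℝ))}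
  [IsProbabilityMeasure γ] {u v : ℝ → ℝ → ℝ} {uB vB : Y → (Fin N → ℝ) → ℝ} {y₀ : Y}

/-- Incentive compatible utilities for the productive component are implemented by a mechanism
without costly screening. -/
theorem mechanism_of_productive (hγ : ∀ᵐ θ ∂γ, θ ∈ ΘA ×ˢ ΘB)
    (hu : Continuous fun z : ℝ × ℝ => u z.1 z.2) (hv : Continuous fun z : ℝ × ℝ => v z.1 z.2)
    {M C : ℝ} (hM : ∀ x ∈ X, ∀ a ∈ ΘA, |u x a| ≤ M)
    (huB0 : ∀ b, uB y₀ b = 0) (hvB0 : ∀ b, vB y₀ b = 0) {f g : ℝ → ℝ}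
    (hf : Measurable f) (hg : Measurable g) (hfg : ∀ a ∈ ΘA, f a ∈ X ∧ 0 ≤ g a ∧ g a ≤ C)
    (hIC : ∀ a ∈ ΘA, ∀ a' ∈ ΘA, g a + (u (f a) a' - u (f a) a) ≤ g a') :
    Mechanism ΘA ΘB X u uB γ (fun θ => f θ.1) (fun _ => y₀) (fun θ => u (f θ.1) θ.1 - g θ.1) ∧
      Payoff v vB γ (fun θ => f θ.1) (fun _ => y₀) (fun θ => u (f θ.1) θ.1 - g θ.1) =
        ∫ a, (u (f a) a + v (f a) a - g a) ∂γ.fst := by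
  have hum : Measurable fun a => u (f a) a := hu.measurable.comp (hf.prodMk measurable_id)
  have hvm : Measurable fun a => v (f a) a := hv.measurable.comp (hf.prodMk measurable_id)
  refine ⟨⟨hf.comp measurable_fst, measurable_const, (hum.sub hg).comp measurable_fst, ?_,
    fun θ hθ => (hfg _ hθ.1).1, fun θ hθ θ' hθ' => ?_, fun θ hθ => ?_⟩, ?_⟩
  · refine Integrable.of_bound ((hum.sub hg).comp measurable_fst).aestronglyMeasurable (M + C) ?_
    filter_upwards [hγ] with θ hθ
    obtain ⟨h1, h2, h3⟩ := hfg _ hθ.1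
    change |u (f θ.1) θ.1 - g θ.1| ≤ M + C
    refine (abs_sub _ _).trans (add_le_add (hM _ h1 _ hθ.1) ?_)
    rwa [abs_of_nonneg h2]
  · have := hIC _ hθ'.1 _ hθ.1
    simp only [huB0]
    linarith
  · have := (hfg _ hθ.1).2.1
    simp only [huB0]
    linarith
  · have hmeas : Measurable fun a => u (f a) a + v (f a) a - g a := (hum.add hvm).sub hg
    rw [Payoff, Measure.fst, integral_map measurable_fst.aemeasurable hmeas.aestronglyMeasurable]
    refine integral_congr_ae (ae_of_all _ fun θ => ?_)
    simp only [hvB0]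
    ring

/-- The payoff of a mechanism is bounded by the surplus, and up to `ε` by the payoff of monotone
screening of rounded productive types. -/
theorem payoff_le_approximation (hγ : ∀ᵐ θ ∂γ, θ ∈ ΘA ×ˢ ΘB)
    (hΘA : IsCompact ΘA) (hΘB : IsCompact ΘB) (hX : IsCompact X) (hXne : X.Nonempty)
    (hu : Continuous fun z : ℝ × ℝ => u z.1 z.2) (hv : Continuous fun z : ℝ × ℝ => v z.1 z.2)
    {M S : ℝ} (hM : ∀ x ∈ X, ∀ a ∈ ΘA, |u x a| ≤ M) (hS : ∀ x ∈ X, ∀ a ∈ ΘA, |u x a + v x a| ≤ S)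
    (huBmeas : Measurable fun z : Y × (Fin N → ℝ) => uB z.1 z.2)
    (hvBmeas : Measurable fun z : Y × (Fin N → ℝ) => vB z.1 z.2)
    (huBbdd : ∃ M, ∀ y, ∀ b ∈ ΘB, |uB y b| ≤ M) (hvBbdd : ∃ M, ∀ y, ∀ b ∈ ΘB, |vB y b| ≤ M)
    (hsB : ∀ y, ∀ b ∈ ΘB, uB y b + vB y b ≤ 0)
    (hmono : ∀ x ∈ X, ∀ a ∈ ΘA, ∀ a' ∈ ΘA, a ≤ a' → u x a ≤ u x a')
    (hid : ∀ x ∈ X, ∀ x' ∈ X, x < x' → ∀ a ∈ ΘA, ∀ a' ∈ ΘA, a < a' →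
      u x' a - u x a < u x' a' - u x a')
    (hsc : ∀ x ∈ X, ∀ x' ∈ X, x < x' → ∀ a ∈ ΘA, ∀ a' ∈ ΘA, a < a' →
      0 < (u x' a + v x' a) - (u x a + v x a) → 0 < (u x' a' + v x' a') - (u x a' + v x a'))
    (huBmono : ∀ y : Y, ∀ b ∈ ΘB, ∀ b' ∈ ΘB, b ≤ b' → uB y b ≤ uB y b')
    (hdom : ∃ κ : Kernel ℝ (Fin N → ℝ), IsRCD γ κ ∧
      ∀ a ∈ MSupport γ.fst, ∀ a' ∈ MSupport γ.fst, a < a' →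
        ∀ f : (Fin N → ℝ) → ℝ, Measurable f → Monotone f → (∃ M, ∀ b, |f b| ≤ M) →
          ∫ b, f b ∂(κ a) ≤ ∫ b, f b ∂(κ a'))
    {x : ℝ × (Fin N → ℝ) → ℝ} {y : ℝ × (Fin N → ℝ) → Y} {t : ℝ × (Fin N → ℝ) → ℝ}
    (hm : Mechanism ΘA ΘB X u uB γ x y t) :
    Payoff v vB γ x y t ≤ S ∧ ∀ ε > 0, ∃ r f g : ℝ → ℝ, MonotoneOn f ΘA ∧ MonotoneOn g ΘA ∧
      (∀ a ∈ ΘA, f a ∈ X ∧ 0 ≤ g a ∧ g a ≤ 2 * M ∧ r a ∈ ΘA ∧ |r a - a| ≤ ε) ∧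
      (∀ a ∈ ΘA, ∀ a' ∈ ΘA, g a + (u (f a) (r a') - u (f a) (r a)) ≤ g a') ∧
      (Measurable fun a => u (f a) (r a) + v (f a) (r a) - g a) ∧
      Payoff v vB γ x y t ≤ ∫ a, (u (f a) (r a) + v (f a) (r a) - g a) ∂γ.fst + ε := by
  obtain ⟨κ, hκ, hdom⟩ := hdom
  have hMarkov := hκ.1
  have hγκ := hκ.eq_compProd
  obtain ⟨hx, hy, ht, hti, hxX, hIC, hIR⟩ := hm
  obtain ⟨MB, hMB⟩ := huBbdd
  obtain ⟨MV, hMV⟩ := hvBbdd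
  let U : ℝ × (Fin N → ℝ) → ℝ := fun θ => u (x θ) θ.1 + uB (y θ) θ.2 - t θ
  have huBm : Measurable fun θ : ℝ × (Fin N → ℝ) => uB (y θ) θ.2 :=
    huBmeas.comp (hy.prodMk measurable_snd)
  have hvBm : Measurable fun θ : ℝ × (Fin N → ℝ) => vB (y θ) θ.2 :=
    hvBmeas.comp (hy.prodMk measurable_snd)
  have hum : Measurable fun θ : ℝ × (Fin N → ℝ) => u (x θ) θ.1 :=
    hu.measurable.comp (hx.prodMk measurable_fst)
  have hvm : Measurable fun θ : ℝ × (Fin N → ℝ) => v (x θ) θ.1 :=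
    hv.measurable.comp (hx.prodMk measurable_fst)
  have hUm : Measurable U := (hum.add huBm).sub ht
  have hICU : ∀ θ ∈ ΘA ×ˢ ΘB, ∀ θ' ∈ ΘA ×ˢ ΘB,
      U θ' + (u (x θ') θ.1 - u (x θ') θ'.1) + (uB (y θ') θ.2 - uB (y θ') θ'.2) ≤ U θ := by
    intro θ hθ θ' hθ'
    have := hIC θ hθ θ' hθ'
    simp only [U]
    linarith
  obtain ⟨C, hC⟩ : ∃ C, ∀ θ ∈ ΘA ×ˢ ΘB, U θ ≤ C := by
    obtain ⟨θ₀, hθ₀⟩ := hγ.exists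
    refine ⟨U θ₀ + 2 * M + 2 * MB, fun θ hθ => ?_⟩
    have h1 := hICU θ₀ hθ₀ θ hθ
    have h2 := abs_le.1 (hM _ (hxX θ hθ) _ hθ.1)
    have h3 := abs_le.1 (hM _ (hxX θ hθ) _ hθ₀.1)
    have h4 := abs_le.1 (hMB (y θ) _ hθ.2)
    have h5 := abs_le.1 (hMB (y θ) _ hθ₀.2)
    linarith
  have hU0 : ∀ θ ∈ ΘA ×ˢ ΘB, 0 ≤ U θ := hIR
  let h : ℝ × (Fin N → ℝ) → ℝ := fun θ => u (x θ) θ.1 + v (x θ) θ.1 - U θ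
  have hhm : Measurable h := (hum.add hvm).sub hUm
  have hhi : Integrable h γ := by
    refine Integrable.of_bound hhm.aestronglyMeasurable (S + C) (hγ.mono fun θ hθ => ?_)
    refine (abs_sub _ _).trans (add_le_add (hS _ (hxX θ hθ) _ hθ.1) ?_)
    rw [abs_of_nonneg (hU0 θ hθ)]
    exact hC θ hθ
  have hpi : Integrable (fun θ => v (x θ) θ.1 + vB (y θ) θ.2 + t θ) γ := by
    refine Integrable.add (Integrable.of_bound (hvm.add hvBm).aestronglyMeasurable (S + M + MV)
      (hγ.mono fun θ hθ => ?_)) hti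
    have h1 := abs_le.1 (hS _ (hxX θ hθ) _ hθ.1)
    have h2 := abs_le.1 (hM _ (hxX θ hθ) _ hθ.1)
    have h3 := abs_le.1 (hMV (y θ) _ hθ.2)
    exact abs_le.2 ⟨by linarith, by linarith⟩
  have hle : Payoff v vB γ x y t ≤ ∫ θ, h θ ∂γ := by
    refine integral_mono_ae hpi hhi (hγ.mono fun θ hθ => ?_)
    have := hsB (y θ) _ hθ.2
    simp only [h, U]
    linarith
  have hleS : ∫ θ, h θ ∂γ ≤ S := by
    have := integral_mono_ae hhi (integrable_const S) (hγ.mono fun θ hθ => by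
      have h1 := hU0 θ hθ
      have h2 := (abs_le.1 (hS _ (hxX θ hθ) _ hθ.1)).2
      change u (x θ) θ.1 + v (x θ) θ.1 - U θ ≤ S
      linarith)
    simpa using this
  refine ⟨hle.trans hleS, fun ε hε => ?_⟩
  have hdis : ∫ θ, h θ ∂γ = ∫ a, ∫ b, h (a, b) ∂κ a ∂γ.fst := by
    conv_lhs => rw [hγκ]
    exact Measure.integral_compProd (hγκ ▸ hhi)
  have hae : ∀ᵐ a ∂γ.fst, ∀ᵐ b ∂κ a, (a, b) ∈ ΘA ×ˢ ΘB := by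
    refine Measure.ae_ae_of_ae_compProd (p := fun θ => θ ∈ ΘA ×ˢ ΘB) ?_
    rwa [← hγκ]
  have hGae : ∀ᵐ a ∂γ.fst, a ∈ MSupport γ.fst ∧ ∀ᵐ b ∂κ a, b ∈ ΘB := by
    filter_upwards [ae_mem_msupport γ.fst, hae] with a h1 h2
    exact ⟨h1, h2.mono fun b hb => hb.2⟩
  have hΘae : ∀ᵐ a ∂γ.fst, a ∈ ΘA := by
    filter_upwards [hae] with a ha
    exact ha.exists.choose_spec.1
  obtain ⟨r, f, g, hf, hg, hfg, hICf, hmeas, hfin⟩ := exists_monotone_approximation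
    (s := fun x a => u x a + v x a) (x := x) (U := U) (μ := γ.fst) (κ := κ)
    (G := {a | a ∈ MSupport γ.fst ∧ ∀ᵐ b ∂κ a, b ∈ ΘB}) hΘA hX hXne hΘB.measurableSet hu
    (hu.add hv) hM hS hmono hid hsc hΘae hGae (fun a ha => ha.2)
    (fun a ha a' ha' haa => hdom a ha.1 a' ha'.1 haa) hx hUm hxX hU0 hC
    (fun a ha b hb b' hb' hbb => by
      have h1 := hICU (a, b') ⟨ha, hb'⟩ (a, b) ⟨ha, hb⟩
      have h2 := huBmono (y (a, b)) b hb b' hb' hbb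
      change U (a, b) ≤ U (a, b')
      simp only at h1
      linarith)
    (fun a ha a' ha' b hb => by
      have h1 := hICU (a', b) ⟨ha', hb⟩ (a, b) ⟨ha, hb⟩
      simp only at h1
      linarith) hε
  exact ⟨r, f, g, hf, hg, hfg, hICf, hmeas, (hle.trans_eq hdis).trans hfin⟩

/-- The optimality of mechanisms without costly screening when the productive utilities are
continuous on the whole plane. -/
theorem exists_optimal_of_continuous (hγ : ∀ᵐ θ ∂γ, θ ∈ ΘA ×ˢ ΘB)
    (hΘA : IsCompact ΘA) (hΘB : IsCompact ΘB) (hX : IsCompact X) (hXne : X.Nonempty)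
    (hu : Continuous fun z : ℝ × ℝ => u z.1 z.2) (hv : Continuous fun z : ℝ × ℝ => v z.1 z.2)
    (huBmeas : Measurable fun z : Y × (Fin N → ℝ) => uB z.1 z.2)
    (hvBmeas : Measurable fun z : Y × (Fin N → ℝ) => vB z.1 z.2)
    (huBbdd : ∃ M, ∀ y, ∀ b ∈ ΘB, |uB y b| ≤ M) (hvBbdd : ∃ M, ∀ y, ∀ b ∈ ΘB, |vB y b| ≤ M)
    (hsB : ∀ y, ∀ b ∈ ΘB, uB y b + vB y b ≤ 0)
    (huB0 : ∀ b, uB y₀ b = 0) (hvB0 : ∀ b, vB y₀ b = 0)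
    (hmono : ∀ x ∈ X, ∀ a ∈ ΘA, ∀ a' ∈ ΘA, a ≤ a' → u x a ≤ u x a')
    (hid : ∀ x ∈ X, ∀ x' ∈ X, x < x' → ∀ a ∈ ΘA, ∀ a' ∈ ΘA, a < a' →
      u x' a - u x a < u x' a' - u x a')
    (hsc : ∀ x ∈ X, ∀ x' ∈ X, x < x' → ∀ a ∈ ΘA, ∀ a' ∈ ΘA, a < a' →
      0 < (u x' a + v x' a) - (u x a + v x a) → 0 < (u x' a' + v x' a') - (u x a' + v x a'))
    (huBmono : ∀ y : Y, ∀ b ∈ ΘB, ∀ b' ∈ ΘB, b ≤ b' → uB y b ≤ uB y b')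
    (hdom : ∃ κ : Kernel ℝ (Fin N → ℝ), IsRCD γ κ ∧
      ∀ a ∈ MSupport γ.fst, ∀ a' ∈ MSupport γ.fst, a < a' →
        ∀ f : (Fin N → ℝ) → ℝ, Measurable f → Monotone f → (∃ M, ∀ b, |f b| ≤ M) →
          ∫ b, f b ∂(κ a) ≤ ∫ b, f b ∂(κ a')) :
    ∃ x y t, Mechanism ΘA ΘB X u uB γ x y t ∧ NoCostlyScreening y₀ x y t ∧
      ∀ x' y' t', Mechanism ΘA ΘB X u uB γ x' y' t' →
        Payoff v vB γ x' y' t' ≤ Payoff v vB γ x y t := by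
  have hbdd : ∀ w : ℝ → ℝ → ℝ, (Continuous fun z : ℝ × ℝ => w z.1 z.2) →
      ∃ M, ∀ x ∈ X, ∀ a ∈ ΘA, |w x a| ≤ M := fun w hw => by
    obtain ⟨M, hM⟩ := (hX.prod hΘA).exists_bound_of_continuousOn hw.continuousOn
    exact ⟨M, fun x hx a ha => hM (x, a) ⟨hx, ha⟩⟩
  obtain ⟨M, hM⟩ := hbdd u hu
  obtain ⟨S, hS⟩ := hbdd (fun x a => u x a + v x a) (hu.add hv)
  have happrox := fun x y t => payoff_le_approximation (x := x) (y := y) (t := t) (vB := vB) hγ hΘA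
    hΘB hX hXne hu hv hM hS huBmeas hvBmeas huBbdd hvBbdd hsB hmono hid hsc huBmono hdom
  let P : Set ℝ := {c | ∃ x y t, Mechanism ΘA ΘB X u uB γ x y t ∧ c = Payoff v vB γ x y t}
  have hP : BddAbove P := by
    refine ⟨S, ?_⟩
    rintro _ ⟨x, y, t, hm, rfl⟩
    exact (happrox x y t hm).1
  have hPne : P.Nonempty := by
    obtain ⟨x₀, hx₀⟩ := hXne
    obtain ⟨θ₀, hθ₀⟩ := hγ.exists
    obtain ⟨a₀, ha₀, hmin⟩ := hΘA.exists_isLeast ⟨θ₀.1, hθ₀.1⟩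
    have hcont : Continuous fun a => u x₀ a := hu.comp (by fun_prop : Continuous fun a => (x₀, a))
    refine ⟨_, _, _, _, (mechanism_of_productive (y₀ := y₀) (vB := vB) (C := 2 * M) (f := fun _ => x₀)
      (g := fun a => u x₀ a - u x₀ a₀) hγ hu hv hM huB0 hvB0 measurable_const
      (hcont.measurable.sub_const _) (fun a ha => ⟨hx₀, ?_, ?_⟩) fun a _ a' _ => ?_).1, rfl⟩
    · exact sub_nonneg.2 (hmono x₀ hx₀ a₀ ha₀ a ha (hmin ha))
    · have h1 := abs_le.1 (hM x₀ hx₀ a ha)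
      have h2 := abs_le.1 (hM x₀ hx₀ a₀ ha₀)
      linarith
    · linarith
  have hΘae : ∀ᵐ a ∂γ.fst, a ∈ ΘA := by
    rw [Measure.fst]
    exact (ae_map_iff measurable_fst.aemeasurable hΘA.measurableSet).2
      (hγ.mono fun θ hθ => hθ.1)
  obtain ⟨f, g, hf, hg, hfg, hIC, hc⟩ := exists_monotone_limit (u := u)
    (s := fun x a => u x a + v x a) (C := 2 * M) (c := sSup P) hX hu (hu.add hv) hS hΘae
    (fun ε hε => by
      obtain ⟨_, ⟨x, y, t, hm, rfl⟩, hlt⟩ := exists_lt_of_lt_csSup hPne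
        (sub_lt_self (sSup P) (half_pos hε))
      obtain ⟨r, f, g, h1, h2, h3, h4, h5, h6⟩ := (happrox x y t hm).2 (ε / 2) (half_pos hε)
      refine ⟨r, f, g, h1, h2, fun a ha => ?_, h4, h5, by linarith⟩
      obtain ⟨i1, i2, i3, i4, i5⟩ := h3 a ha
      exact ⟨i1, i2, i3, i4, by linarith⟩)
  obtain ⟨hmech, hpay⟩ := mechanism_of_productive (y₀ := y₀) hγ hu hv hM huB0 hvB0 hf.measurable
    hg.measurable hfg hIC
  refine ⟨_, _, _, hmech, ⟨fun _ => rfl, fun θ θ' hθ => ?_⟩, fun x y t hm => ?_⟩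
  · simp only [hθ, and_self]
  · rw [hpay]
    exact (le_csSup hP ⟨x, y, t, hm, rfl⟩).trans hc

end ContinuousUtilities

/-- **Theorem 1(i).** Under Assumption 1 (standard productive component) and
Assumption 2 (positively correlated preferences), there exists an optimal mechanism
that involves no costly screening. -/
theorem stmt0
    (y₀ : Y) (hy₀ : MeasurableSet ({y₀} : Set Y))
    (ΘA : Set ℝ) (ΘB : Set (Fin N → ℝ)) (X : Set ℝ)
    (hΘA : IsCompact ΘA) (hΘB : IsCompact ΘB) (hX : IsCompact X) (hXne : X.Nonempty)
    (γ : Measure (ℝ × (Fin N → ℝ))) (hγp : IsProbabilityMeasure γ)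
    (hγsupp : γ ((ΘA ×ˢ ΘB)ᶜ) = 0)
    (uA vA : ℝ → ℝ → ℝ)
    (huAc : ContinuousOn (fun p : ℝ × ℝ => uA p.1 p.2) (X ×ˢ ΘA))
    (hvAc : ContinuousOn (fun p : ℝ × ℝ => vA p.1 p.2) (X ×ˢ ΘA))
    (uB vB : Y → (Fin N → ℝ) → ℝ)
    (huBmeas : Measurable (fun p : Y × (Fin N → ℝ) => uB p.1 p.2))
    (hvBmeas : Measurable (fun p : Y × (Fin N → ℝ) => vB p.1 p.2))
    (huBbdd : ∃ M, ∀ y, ∀ b ∈ ΘB, |uB y b| ≤ M)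
    (hvBbdd : ∃ M, ∀ y, ∀ b ∈ ΘB, |vB y b| ≤ M)
    -- the instruments are (weakly) costly
    (hsB : ∀ y, ∀ b ∈ ΘB, uB y b + vB y b ≤ 0)
    (huB0 : ∀ b, uB y₀ b = 0) (hvB0 : ∀ b, vB y₀ b = 0)
    -- Assumption 1.1: uA nondecreasing in the type
    (h11 : ∀ x ∈ X, ∀ a ∈ ΘA, ∀ a' ∈ ΘA, a ≤ a' → uA x a ≤ uA x a')
    -- Assumption 1.2: strict increasing differences
    (h12 : ∀ x ∈ X, ∀ x' ∈ X, x < x' → ∀ a ∈ ΘA, ∀ a' ∈ ΘA, a < a' →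
      uA x' a - uA x a < uA x' a' - uA x a')
    -- Assumption 1.3: weak single-crossing differences of the surplus
    (h13 : ∀ x ∈ X, ∀ x' ∈ X, x < x' → ∀ a ∈ ΘA, ∀ a' ∈ ΘA, a < a' →
      0 < (uA x' a + vA x' a) - (uA x a + vA x a) →
      0 < (uA x' a' + vA x' a') - (uA x a' + vA x a'))
    -- Assumption 2.1: uB nondecreasing in the costly type
    (h21 : ∀ y : Y, ∀ b ∈ ΘB, ∀ b' ∈ ΘB, b ≤ b' → uB y b ≤ uB y b')
    -- Assumption 2.2: θ^B stochastically nondecreasing in θ^A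
    (h22 : ∃ κ : Kernel ℝ (Fin N → ℝ), IsRCD γ κ ∧
      ∀ a ∈ MSupport γ.fst, ∀ a' ∈ MSupport γ.fst, a < a' →
        ∀ f : (Fin N → ℝ) → ℝ, Measurable f → Monotone f →
          (∃ M, ∀ b, |f b| ≤ M) →
          ∫ b, f b ∂(κ a) ≤ ∫ b, f b ∂(κ a')) :
    ∃ x y t, Mechanism ΘA ΘB X uA uB γ x y t ∧ NoCostlyScreening y₀ x y t ∧
      ∀ x' y' t', Mechanism ΘA ΘB X uA uB γ x' y' t' →
        Payoff vA vB γ x' y' t' ≤ Payoff vA vB γ x y t := by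
  have hγ : ∀ᵐ θ ∂γ, θ ∈ ΘA ×ˢ ΘB := hγsupp
  have hext : ∀ w : ℝ → ℝ → ℝ, ContinuousOn (fun p : ℝ × ℝ => w p.1 p.2) (X ×ˢ ΘA) →
      ∃ w' : ℝ → ℝ → ℝ, (Continuous fun z : ℝ × ℝ => w' z.1 z.2) ∧
        ∀ x ∈ X, ∀ a ∈ ΘA, w x a = w' x a := by
    intro w hw
    obtain ⟨g, hg⟩ := ContinuousMap.exists_restrict_eq (hX.prod hΘA).isClosed
      ⟨_, continuousOn_iff_continuous_domRestrict.1 hw⟩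
    refine ⟨fun x a => g (x, a), g.continuous, fun x hx a ha => ?_⟩
    exact (DFunLike.congr_fun hg ⟨(x, a), ⟨hx, ha⟩⟩).symm
  obtain ⟨u, hu, huA⟩ := hext uA huAc
  obtain ⟨v, hv, hvA⟩ := hext vA hvAc
  have hpay : ∀ x y t, Mechanism ΘA ΘB X uA uB γ x y t →
      Payoff vA vB γ x y t = Payoff v vB γ x y t := fun x y t hm =>
    integral_congr_ae (hγ.mono fun θ hθ => by
      simp only [hvA _ (hm.2.2.2.2.1 θ hθ) _ hθ.1])
  obtain ⟨x, y, t, hm, hno, hopt⟩ := exists_optimal_of_continuous (u := u) (v := v) (y₀ := y₀)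
    (uB := uB) (vB := vB) hγ hΘA hΘB hX hXne hu hv huBmeas hvBmeas huBbdd hvBbdd hsB huB0 hvB0
    (fun x hx a ha a' ha' h => by
      rw [← huA x hx a ha, ← huA x hx a' ha']
      exact h11 x hx a ha a' ha' h)
    (fun x hx x' hx' hxx a ha a' ha' h => by
      rw [← huA x hx a ha, ← huA x hx a' ha', ← huA x' hx' a ha, ← huA x' hx' a' ha']
      exact h12 x hx x' hx' hxx a ha a' ha' h)
    (fun x hx x' hx' hxx a ha a' ha' h => by
      rw [← huA x hx a ha, ← huA x hx a' ha', ← huA x' hx' a ha, ← huA x' hx' a' ha',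
        ← hvA x hx a ha, ← hvA x hx a' ha', ← hvA x' hx' a ha, ← hvA x' hx' a' ha']
      exact h13 x hx x' hx' hxx a ha a' ha' h)
    h21 h22
  have hm' : Mechanism ΘA ΘB X uA uB γ x y t := hm.congr fun z hz a ha => (huA z hz a ha).symm
  refine ⟨x, y, t, hm', hno, fun x' y' t' hmm => ?_⟩
  rw [hpay _ _ _ hmm, hpay _ _ _ hm']
  exact hopt x' y' t' (hmm.congr huA)
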